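/- arXiv:1810.11242 — 2 statements merged into one kernel-verified Lean document; each statement's English description precedes it below -/
import Mathlib

section
/- Let G be a connected finite simple graph and k ≥ 2 an integer. If α(G) ≤ k + κ(G) − 1, then G has a spanning tree with at most k leaves. -/
open SimpleGraph Set

variable {V : Type*}

/-- The independence number of `S` in `G`: the maximum cardinality of a subset of `S`
that is independent in `G`. -/
noncomputable def indepNumOn (G : SimpleGraph V) (S : Set V) : ℕ :=
  sSup {n | ∃ I : Set V, I ⊆ S ∧ I.Pairwise (fun a b => ¬ G.Adj a b) ∧ I.ncard = n}

/-- `I` is a maximum independent subset of `S` in `G`. -/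
def MaxIndepOn (G : SimpleGraph V) (S : Set V) (I : Set V) : Prop :=
  I ⊆ S ∧ I.Pairwise (fun a b => ¬ G.Adj a b) ∧ I.ncard = indepNumOn G S

/-- Two `x`–`y` walks are internally disjoint if they share only `x` and `y`. -/
def InternallyDisjoint (G : SimpleGraph V) {x y : V} (p q : G.Walk x y) : Prop :=
  ∀ v, v ∈ p.support → v ∈ q.support → v = x ∨ v = y

/-- Local connectivity `κ_G(x,y)`: maximum number of pairwise internally disjoint
`x`–`y` paths in `G`. -/
noncomputable def localConn (G : SimpleGraph V) (x y : V) : ℕ :=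
  sSup {n | ∃ P : Set (G.Path x y),
    P.Pairwise (fun p q => InternallyDisjoint G p.1 q.1) ∧ P.ncard = n}

/-- `κ_G(S)`: the minimum of local connectivities over distinct pairs in `S`,
`+∞` if `S` has at most one element. -/
noncomputable def setConn (G : SimpleGraph V) (S : Set V) : ℕ∞ :=
  ⨅ x ∈ S, ⨅ y ∈ S, ⨅ _ : x ≠ y, (localConn G x y : ℕ∞)

/-- Vertex connectivity `κ(G)`: the maximum `k` such that `G` has more than `k`
vertices and removing fewer than `k` vertices always leaves a connected graph. -/
noncomputable def vertexConn (G : SimpleGraph V) [Fintype V] : ℕ :=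
  sSup {k | k < Fintype.card V ∧ ∀ X : Finset V, X.card < k →
    (G.induce ((↑X : Set V)ᶜ)).Connected}

/-- The set of leaves (vertices of degree one) of a subgraph. -/
def subLeaves {G : SimpleGraph V} (T : G.Subgraph) : Set V :=
  {v | v ∈ T.verts ∧ (T.neighborSet v).ncard = 1}

/-- The set of branch vertices (vertices of degree at least three) of a subgraph. -/
def subBranches {G : SimpleGraph V} (T : G.Subgraph) : Set V :=
  {v | v ∈ T.verts ∧ 3 ≤ (T.neighborSet v).ncard}

/-- `m` is the vertex multiset of a `G`-chain of vertices running from `a` to `b`. -/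
def Seg (G : SimpleGraph V) (a b : V) (m : Multiset V) : Prop :=
  ∃ l : List V, l.head? = some a ∧ l.getLast? = some b ∧ l.IsChain G.Adj ∧ (l : Multiset V) = m

/-- The ends of `l` are equal or adjacent, so that `l` is a single vertex, an edge or a cycle. -/
def ClosedList (G : SimpleGraph V) (l : List V) : Prop :=
  ∃ a b, l.head? = some a ∧ l.getLast? = some b ∧ (a = b ∨ G.Adj a b)

open Classical in
/-- Win's weight of an element of a system of paths and cycles. -/
noncomputable def wt (G : SimpleGraph V) (l : List V) : ℕ :=
  if ClosedList G l then 1 else 2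

/-- `m` can be partitioned into chains of total weight at most `w`. -/
def Sys (G : SimpleGraph V) (m : Multiset V) (w : ℕ) : Prop :=
  ∃ S : Multiset (List V), (∀ l ∈ S, l ≠ [] ∧ l.IsChain G.Adj) ∧
    (S.map (fun l : List V => (l : Multiset V))).sum = m ∧ (S.map (wt G)).sum ≤ w

section Segments

variable {G : SimpleGraph V}

theorem wt_of_closed {l : List V} (h : ClosedList G l) : wt G l = 1 := if_pos h

theorem wt_of_not_closed {l : List V} (h : ¬ ClosedList G l) : wt G l = 2 := if_neg h

theorem wt_le_two (l : List V) : wt G l ≤ 2 := by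
  unfold wt; split_ifs <;> omega

theorem one_le_wt (l : List V) : 1 ≤ wt G l := by
  unfold wt; split_ifs <;> omega

theorem Seg.symm {a b : V} {m : Multiset V} (h : Seg G a b m) : Seg G b a m := by
  obtain ⟨l, h1, h2, h3, h4⟩ := h
  refine ⟨l.reverse, by simpa using h2, by simpa using h1, ?_, by simpa using h4⟩
  rw [List.isChain_reverse]
  exact h3.imp fun _ _ h => h.symm

theorem Seg.join {a b c d : V} {m n : Multiset V} (h : Seg G a b m) (hbc : G.Adj b c)
    (h' : Seg G c d n) : Seg G a d (m + n) := by
  obtain ⟨l, h1, h2, h3, h4⟩ := h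
  obtain ⟨l', h1', h2', h3', h4'⟩ := h'
  refine ⟨l ++ l', by simp [h1], by simp [h2'], ?_, by simp [← h4, ← h4']⟩
  rw [List.isChain_append]
  refine ⟨h3, h3', ?_⟩
  intro x hx y hy
  simp only [h2, h1', Option.mem_def, Option.some.injEq] at hx hy
  subst hx hy
  exact hbc

theorem Seg.single (a : V) : Seg G a a {a} := ⟨[a], by simp⟩

theorem Seg.snoc {a b h : V} {m : Multiset V} (hs : Seg G a b m) (hbh : G.Adj b h) :
    Seg G a h (m + {h}) := hs.join hbh (Seg.single h)

theorem seg_of_list {l : List V} {a b : V} (ha : l.head? = some a) (hb : l.getLast? = some b)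
    (h : l.IsChain G.Adj) : Seg G a b (l : Multiset V) := ⟨l, ha, hb, h, rfl⟩

theorem Seg.sys {a b : V} {m : Multiset V} (h : Seg G a b m) : Sys G m 2 := by
  obtain ⟨l, h1, h2, h3, h4⟩ := h
  refine ⟨{l}, ?_, by simpa using h4, by simpa using wt_le_two l⟩
  intro l' hl'
  rw [Multiset.mem_singleton] at hl'
  subst hl'
  refine ⟨?_, h3⟩
  rintro rfl
  simp at h1

theorem Seg.sys_closed {a b : V} {m : Multiset V} (h : Seg G a b m) (hab : a = b ∨ G.Adj a b) :
    Sys G m 1 := by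
  obtain ⟨l, h1, h2, h3, h4⟩ := h
  refine ⟨{l}, ?_, by simpa using h4, by
    simpa using (wt_of_closed (G := G) ⟨a, b, h1, h2, hab⟩).le⟩
  intro l' hl'
  rw [Multiset.mem_singleton] at hl'
  subst hl'
  refine ⟨?_, h3⟩
  rintro rfl
  simp at h1

theorem Sys.add {m n : Multiset V} {w x : ℕ} (h : Sys G m w) (h' : Sys G n x) :
    Sys G (m + n) (w + x) := by
  obtain ⟨S, h1, h2, h3⟩ := h
  obtain ⟨S', h1', h2', h3'⟩ := h'
  refine ⟨S + S', ?_, by simp [h2, h2'], by simp; omega⟩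
  intro l hl
  rcases Multiset.mem_add.1 hl with h | h
  exacts [h1 l h, h1' l h]

theorem Sys.mono {m : Multiset V} {w x : ℕ} (h : Sys G m w) (hwx : w ≤ x) : Sys G m x := by
  obtain ⟨S, h1, h2, h3⟩ := h
  exact ⟨S, h1, h2, h3.trans hwx⟩

theorem sys_zero : Sys G 0 0 := ⟨0, by simp⟩

end Segments

section Next

variable [DecidableEq V] {G : SimpleGraph V}

theorem List.next_of_append_cons_cons {s t : List V} {y z : V} (hn : (s ++ y :: z :: t).Nodup)
    (h : y ∈ s ++ y :: z :: t) : (s ++ y :: z :: t).next y h = z := by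
  have := List.next_getElem (s ++ y :: z :: t) hn s.length (by simp)
  simp only [List.getElem_append_right le_rfl] at this
  simp only [Nat.sub_self, List.getElem_cons_zero] at this
  rw [this]
  have e : (s.length + 1) % (s.length + (t.length + 1 + 1)) = s.length + 1 :=
    Nat.mod_eq_of_lt (by omega)
  simp [e]

theorem List.exists_eq_append_next {l : List V} (hn : l.Nodup) {y : V} (hy : y ∈ l)
    (hlast : l.getLast? ≠ some y) : ∃ s t, l = s ++ y :: l.next y hy :: t := by
  obtain ⟨s, t, rfl⟩ := List.append_of_mem hy
  cases t with
  | nil => simp at hlast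
  | cons z t => exact ⟨s, t, by rw [List.next_of_append_cons_cons hn]⟩

theorem List.exists_rotation_getLast {l : List V} (hn : l.Nodup) (hc : l.IsChain G.Adj)
    (hcl : ClosedList G l) {y : V} (hy : y ∈ l) :
    ∃ l', l ~r l' ∧ l'.IsChain G.Adj ∧ l'.getLast? = some y ∧ l'.head? = some (l.next y hy) := by
  have key : ∃ l', l ~r l' ∧ l'.IsChain G.Adj ∧ l'.getLast? = some y := by
    obtain ⟨s, t, rfl⟩ := List.append_of_mem hy
    refine ⟨t ++ (s ++ [y]), ?_, ?_, by simp⟩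
    · have := List.isRotated_append (l := s ++ [y]) (l' := t)
      simpa using this
    · rw [List.append_cons, List.isChain_append] at hc
      rw [List.isChain_append]
      refine ⟨hc.2.1, hc.1, ?_⟩
      intro b hb a ha
      obtain ⟨a', b', ha', hb', hab⟩ := hcl
      have hbt : b ∈ t := List.mem_of_getLast? hb
      have has : a ∈ s ++ [y] := List.mem_of_mem_head? ha
      have e1 : a' = a := by
        have : (s ++ y :: t).head? = some a := by
          rw [List.append_cons, List.head?_append]
          simp only [Option.mem_def] at ha
          simp [ha]
        rw [this] at ha'
        simpa using ha'.symm
      have e2 : b' = b := by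
        have : (s ++ y :: t).getLast? = some b := by
          rw [List.append_cons, List.getLast?_append]
          simp only [Option.mem_def] at hb
          simp [hb]
        rw [this] at hb'
        simpa using hb'.symm
      subst e1 e2
      rcases hab with rfl | hab
      · rw [List.append_cons] at hn
        exact (List.disjoint_of_nodup_append hn has hbt).elim
      · exact hab.symm
  obtain ⟨l', hr, hc', hl'⟩ := key
  refine ⟨l', hr, hc', hl', ?_⟩
  have hne : l' ≠ [] := by rintro rfl; simp at hl'
  have hn' : l'.Nodup := hr.nodup_iff.1 hn
  rw [List.isRotated_next_eq hr hn hy]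
  have h1 := List.next_getLast_eq_head l' hne hn'
  have h2 : l'.getLast hne = y := by
    rw [List.getLast?_eq_some_getLast hne] at hl'
    simpa using hl'
  subst h2
  rw [h1, List.head?_eq_some_head]

theorem exists_seg_of_closed {l : List V} (hn : l.Nodup) (hc : l.IsChain G.Adj)
    (hcl : ClosedList G l) {y : V} (hy : y ∈ l) : Seg G (l.next y hy) y l := by
  obtain ⟨l', hr, hc', h1, h2⟩ := List.exists_rotation_getLast hn hc hcl hy
  exact ⟨l', h2, h1, hc', Multiset.coe_eq_coe.2 hr.perm.symm⟩

theorem exists_seg_split {l : List V} (hn : l.Nodup) (hc : l.IsChain G.Adj) {a b y : V}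
    (ha : l.head? = some a) (hb : l.getLast? = some b) (hy : y ∈ l) (hyb : y ≠ b) :
    ∃ p q, Seg G a y p ∧ Seg G (l.next y hy) b q ∧ p + q = (l : Multiset V) := by
  obtain ⟨s, t, e⟩ := List.exists_eq_append_next hn hy (by rw [hb]; simpa using hyb.symm)
  generalize l.next y hy = z at e ⊢
  subst e
  rw [List.append_cons, List.isChain_append] at hc
  refine ⟨(s ++ [y] : List V), (z :: t : List V), ⟨_, ?_, by simp, hc.1, rfl⟩,
    ⟨_, by simp, ?_, hc.2.1, rfl⟩, by simp⟩
  · cases s <;> simpa using ha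
  · rw [List.getLast?_append] at hb
    simpa [List.getLast?_cons_cons] using hb

theorem exists_seg_split_two_aux {s t : List V} {y z y' : V}
    (hn : (s ++ y :: z :: t).Nodup) (hc : (s ++ y :: z :: t).IsChain G.Adj) {a b : V}
    (ha : (s ++ y :: z :: t).head? = some a) (hb : (s ++ y :: z :: t).getLast? = some b)
    (hy' : y' ∈ s ++ y :: z :: t) (hm : y' ∈ z :: t) (hyb' : y' ≠ b) :
    ∃ p q r, Seg G a y p ∧ Seg G z y' q ∧ Seg G ((s ++ y :: z :: t).next y' hy') b r ∧
      p + q + r = ((s ++ y :: z :: t : List V) : Multiset V) := by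
  have hb' : (z :: t).getLast? = some b := by
    rw [List.getLast?_append] at hb
    simpa [List.getLast?_cons_cons] using hb
  have hc2 : (s ++ [y]).IsChain G.Adj ∧ (z :: t).IsChain G.Adj := by
    rw [List.append_cons, List.isChain_append] at hc
    exact ⟨hc.1, hc.2.1⟩
  have hn2 : (z :: t).Nodup := by
    rw [List.append_cons] at hn
    exact hn.of_append_right
  obtain ⟨q, r, hq, hr, hqr⟩ := exists_seg_split hn2 hc2.2 rfl hb' hm hyb'
  have hnext : (s ++ y :: z :: t).next y' hy' = (z :: t).next y' hm := by
    obtain ⟨s', t', e⟩ := List.exists_eq_append_next hn2 hm (by rw [hb']; simpa using hyb'.symm)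
    generalize (z :: t).next y' hm = z' at e ⊢
    simp only [e] at hn ⊢
    have := List.next_of_append_cons_cons (s := s ++ y :: s') (t := t') (y := y') (z := z')
      (by simpa using hn) (by simp)
    simpa using this
  refine ⟨(s ++ [y] : List V), q, r, ⟨_, ?_, by simp, hc2.1, rfl⟩, hq, hnext ▸ hr, ?_⟩
  · cases s <;> simpa using ha
  · rw [add_assoc, hqr]; simp

theorem exists_seg_split_two {l : List V} (hn : l.Nodup) (hc : l.IsChain G.Adj) {a b y y' : V}
    (ha : l.head? = some a) (hb : l.getLast? = some b) (hy : y ∈ l) (hyb : y ≠ b)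
    (hy' : y' ∈ l) (hyb' : y' ≠ b) (hne : y ≠ y') :
    (∃ p q r, Seg G a y p ∧ Seg G (l.next y hy) y' q ∧ Seg G (l.next y' hy') b r ∧
      p + q + r = (l : Multiset V)) ∨
    (∃ p q r, Seg G a y' p ∧ Seg G (l.next y' hy') y q ∧ Seg G (l.next y hy) b r ∧
      p + q + r = (l : Multiset V)) := by
  obtain ⟨s, t, e⟩ := List.exists_eq_append_next hn hy (by rw [hb]; simpa using hyb.symm)
  obtain ⟨s', t', e'⟩ := List.exists_eq_append_next hn hy' (by rw [hb]; simpa using hyb'.symm)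
  by_cases hm : y' ∈ l.next y hy :: t
  · left
    generalize l.next y hy = z at e hm ⊢
    subst e
    exact exists_seg_split_two_aux hn hc ha hb hy' hm hyb'
  · right
    have hm' : y ∈ l.next y' hy' :: t' := by
      generalize l.next y hy = z at e hm ⊢
      generalize l.next y' hy' = z' at e' hm ⊢
      rw [e, List.append_cons, List.append_cons (as := s')] at e'
      rw [List.append_eq_append_iff] at e'
      by_contra hyt
      rcases e' with ⟨u, h1, h2⟩ | ⟨u, h1, h2⟩
      · rcases List.eq_nil_or_concat u with rfl | ⟨u', x, rfl⟩
        · simp at h1; exact hne h1.2.symm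
        · rw [List.concat_eq_append, ← List.append_assoc] at h1
          have := (List.append_inj' h1 rfl).2
          simp at this
          subst this
          exact hm (by rw [h2]; simp)
      · rcases List.eq_nil_or_concat u with rfl | ⟨u', x, rfl⟩
        · simp at h1; exact hne h1.2
        · rw [List.concat_eq_append, ← List.append_assoc] at h1
          have := (List.append_inj' h1 rfl).2
          simp at this
          subst this
          exact hyt (by rw [h2]; simp)
    generalize l.next y' hy' = z at e' hm' ⊢
    subst e'
    exact exists_seg_split_two_aux hn hc ha hb hy hm' hyb

theorem exists_seg_split_two_of_closed {l : List V} (hn : l.Nodup) (hc : l.IsChain G.Adj)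
    (hcl : ClosedList G l) {y y' : V} (hy : y ∈ l) (hy' : y' ∈ l) (hne : y ≠ y') :
    ∃ p q, Seg G (l.next y hy) y' p ∧ Seg G (l.next y' hy') y q ∧ p + q = (l : Multiset V) := by
  obtain ⟨l', hr, hc', h1, h2⟩ := List.exists_rotation_getLast hn hc hcl hy
  obtain ⟨p, q, hp, hq, e⟩ := exists_seg_split (hr.nodup_iff.1 hn) hc' h2 h1
    (hr.mem_iff.1 hy') hne.symm
  refine ⟨p, q, hp, ?_, e.trans (Multiset.coe_eq_coe.2 hr.perm.symm)⟩
  rwa [List.isRotated_next_eq hr hn hy']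

theorem List.next_injective {l : List V} (hn : l.Nodup) {y y' : V} (hy : y ∈ l) (hy' : y' ∈ l)
    (h : l.next y hy = l.next y' hy') : y = y' := by
  have h1 := List.prev_next l hn y hy
  have h2 := List.prev_next l hn y' hy'
  rw [← h1, ← h2]
  congr 1

end Next

/-- The multiset of vertices occurring in the members of `E`. -/
def coverOf (E : Finset (List V)) : Multiset V := ∑ l ∈ E, (l : Multiset V)

/-- The total weight of `E`. -/
noncomputable def weightOf (G : SimpleGraph V) (E : Finset (List V)) : ℕ := ∑ l ∈ E, wt G l

/-- `F` is a system of disjoint chains which cannot be enlarged within its weight, and in which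
no two closed members can be merged. -/
structure IsMaximalSys (G : SimpleGraph V) (F : Finset (List V)) : Prop where
  ne_nil : ∀ l ∈ F, l ≠ []
  chain : ∀ l ∈ F, l.IsChain G.Adj
  nodup : (coverOf F).Nodup
  maximal : ∀ q ≠ 0, (coverOf F + q).Nodup → ¬ Sys G (coverOf F + q) (weightOf G F)
  closed_not_adj : ∀ l ∈ F, ∀ l' ∈ F, l ≠ l' → ClosedList G l → ClosedList G l' →
    ∀ v ∈ l, ∀ w ∈ l', ¬ G.Adj v w

/-- Any two vertices of `A` are joined through chains outside `F`. -/
structure IsAttached (G : SimpleGraph V) (F : Finset (List V)) (A : Set V) : Prop where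
  mem_cover : ∀ y ∈ A, y ∈ coverOf F
  link : ∀ y ∈ A, ∀ y' ∈ A, ∃ h h' q, G.Adj y h ∧ G.Adj h' y' ∧ Seg G h h' q ∧
    (coverOf F + q).Nodup

/-- `r` may represent the member `l`: an end of `l` if `l` is not closed, and a vertex
outside `A`. -/
structure IsRep (G : SimpleGraph V) (A : Set V) (l : List V) (r : V) : Prop where
  mem : r ∈ l
  notMem : r ∉ A
  isEnd : ¬ ClosedList G l → l.head? = some r ∨ l.getLast? = some r

section Extremal

variable {G : SimpleGraph V} {F : Finset (List V)} {A : Set V}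

theorem mem_coverOf {v : V} : v ∈ coverOf F ↔ ∃ l ∈ F, v ∈ l := by
  simp [coverOf, Multiset.mem_sum]

theorem Seg.ne_zero {a b : V} {m : Multiset V} (h : Seg G a b m) : m ≠ 0 := by
  obtain ⟨l, h1, -, -, rfl⟩ := h
  rintro h
  simp only [Multiset.coe_eq_zero] at h
  simp [h] at h1

theorem Seg.left_mem {a b : V} {m : Multiset V} (h : Seg G a b m) : a ∈ m := by
  obtain ⟨l, h1, -, -, rfl⟩ := h
  exact List.mem_of_mem_head? h1

theorem Seg.right_mem {a b : V} {m : Multiset V} (h : Seg G a b m) : b ∈ m := h.symm.left_mem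

theorem exists_ends {l : List V} (h : l ≠ []) :
    ∃ a b, l.head? = some a ∧ l.getLast? = some b :=
  ⟨_, _, List.head?_eq_some_head h, List.getLast?_eq_some_getLast h⟩

theorem ends_of_not_closed {l : List V} (h : ¬ ClosedList G l) {a b : V}
    (ha : l.head? = some a) (hb : l.getLast? = some b) : a ≠ b ∧ ¬ G.Adj a b :=
  ⟨fun e => h ⟨a, b, ha, hb, Or.inl e⟩, fun e => h ⟨a, b, ha, hb, Or.inr e⟩⟩

theorem sys_cover {E : Finset (List V)} (h1 : ∀ l ∈ E, l ≠ []) (h2 : ∀ l ∈ E, l.IsChain G.Adj) :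
    Sys G (coverOf E) (weightOf G E) :=
  ⟨E.val, fun l hl => ⟨h1 l hl, h2 l hl⟩, rfl, le_rfl⟩

theorem coverOf_singleton (l : List V) : coverOf {l} = (l : Multiset V) := by simp [coverOf]

theorem weightOf_singleton (l : List V) : weightOf G {l} = wt G l := by simp [weightOf]

theorem IsAttached.exists_adj (hA : IsAttached G F A) {y : V} (hy : y ∈ A) :
    ∃ h, G.Adj y h ∧ (coverOf F + {h}).Nodup := by
  obtain ⟨h, h', q, h1, -, h3, h4⟩ := hA.link y hy y hy
  refine ⟨h, h1, Multiset.nodup_of_le ?_ h4⟩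
  gcongr
  exact Multiset.singleton_le.2 h3.left_mem

variable [DecidableEq V]

theorem coverOf_pair {l l' : List V} (h : l ≠ l') :
    coverOf {l, l'} = (l : Multiset V) + (l' : Multiset V) := by
  simp [coverOf, Finset.sum_pair h]

theorem weightOf_pair {l l' : List V} (h : l ≠ l') :
    weightOf G {l, l'} = wt G l + wt G l' := by
  simp [weightOf, Finset.sum_pair h]

theorem coverOf_le {E : Finset (List V)} (hE : E ⊆ F) : coverOf E ≤ coverOf F := by
  have e1 : coverOf (F \ E) + coverOf E = coverOf F := Finset.sum_sdiff hE
  rw [← e1]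
  exact Multiset.le_add_left _ _

namespace IsMaximalSys

theorem no_sys (hF : IsMaximalSys G F) {E : Finset (List V)} (hE : E ⊆ F) {q m : Multiset V}
    {w : ℕ} (hq : q ≠ 0)
    (hnd : (coverOf F + q).Nodup) (hs : Sys G m w) (hm : m = coverOf E + q)
    (hw : w ≤ weightOf G E) : False := by
  apply hF.maximal q hq hnd
  have h1 : Sys G (coverOf (F \ E)) (weightOf G (F \ E)) :=
    sys_cover (fun l hl => hF.ne_nil l (Finset.mem_sdiff.1 hl).1)
      (fun l hl => hF.chain l (Finset.mem_sdiff.1 hl).1)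
  have h2 := (hs.mono hw).add h1
  have e1 : coverOf (F \ E) + coverOf E = coverOf F := Finset.sum_sdiff hE
  have e2 : weightOf G (F \ E) + weightOf G E = weightOf G F := Finset.sum_sdiff hE
  rw [hm] at h2
  rw [← e1, ← e2, add_comm (weightOf G _)]
  convert h2 using 1
  abel

theorem no_sys_one (hF : IsMaximalSys G F) {l : List V} (hl : l ∈ F) {q m : Multiset V} {w : ℕ}
    (hq : q ≠ 0)
    (hnd : (coverOf F + q).Nodup) (hs : Sys G m w) (hm : m = l + q) (hw : w ≤ wt G l) :
    False :=
  hF.no_sys (Finset.singleton_subset_iff.2 hl) hq hnd hs (by rw [hm, coverOf_singleton])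
    (by rwa [weightOf_singleton])

theorem no_sys_two (hF : IsMaximalSys G F) {l l' : List V} (hl : l ∈ F) (hl' : l' ∈ F)
    (hll : l ≠ l')
    {q m : Multiset V} {w : ℕ} (hq : q ≠ 0)
    (hnd : (coverOf F + q).Nodup) (hs : Sys G m w) (hm : m = l + l' + q)
    (hw : w ≤ wt G l + wt G l') : False :=
  hF.no_sys (E := {l, l'}) (by simp [Finset.insert_subset_iff, hl, hl']) hq hnd hs
    (by rw [hm, coverOf_pair hll]) (by rwa [weightOf_pair hll])

theorem list_nodup (hF : IsMaximalSys G F) {l : List V} (hl : l ∈ F) : l.Nodup := by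
  have := coverOf_le (Finset.singleton_subset_iff.2 hl)
  rw [coverOf_singleton] at this
  exact Multiset.coe_nodup.1 (Multiset.nodup_of_le this hF.nodup)

theorem eq_of_mem (hF : IsMaximalSys G F) {l l' : List V} (hl : l ∈ F) (hl' : l' ∈ F) {v : V}
    (hv : v ∈ l)
    (hv' : v ∈ l') : l = l' := by
  by_contra hll
  have := coverOf_le (E := {l, l'}) (F := F) (by simp [Finset.insert_subset_iff, hl, hl'])
  rw [coverOf_pair hll] at this
  have := Multiset.nodup_of_le this hF.nodup
  rw [Multiset.nodup_add] at this
  exact Multiset.disjoint_left.1 this.2.2 (by simpa using hv) (by simpa using hv')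

theorem end_notMem (hF : IsMaximalSys G F) {l : List V} (hl : l ∈ F) (hc : ¬ ClosedList G l)
    (hA : IsAttached G F A)
    {e r : V} (hs : Seg G e r l) : r ∉ A := by
  intro hr
  obtain ⟨h, h1, h2⟩ := hA.exists_adj hr
  exact hF.no_sys_one hl (by simp) h2 (hs.snoc h1).sys rfl (wt_of_not_closed hc).ge

theorem ends_notMem (hF : IsMaximalSys G F) {l : List V} (hl : l ∈ F) (hc : ¬ ClosedList G l)
    (hA : IsAttached G F A)
    {a b : V} (ha : l.head? = some a) (hb : l.getLast? = some b) : a ∉ A ∧ b ∉ A :=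
  have hs := seg_of_list ha hb (hF.chain l hl)
  ⟨hF.end_notMem hl hc hA hs.symm, hF.end_notMem hl hc hA hs⟩

end IsMaximalSys

theorem IsRep.exists_seg {l : List V} {r : V} (hr : IsRep G A l r) (hF : IsMaximalSys G F)
    (hl : l ∈ F) : ∃ e, Seg G e r l := by
  by_cases hc : ClosedList G l
  · exact ⟨_, exists_seg_of_closed (hF.list_nodup hl) (hF.chain l hl) hc hr.mem⟩
  · obtain ⟨a, b, ha, hb⟩ := exists_ends (hF.ne_nil l hl)
    have hs := seg_of_list ha hb (hF.chain l hl)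
    rcases hr.isEnd hc with h | h
    · rw [ha] at h
      cases h
      exact ⟨b, hs.symm⟩
    · rw [hb] at h
      cases h
      exact ⟨a, hs⟩

end Extremal

section Successors

variable {G : SimpleGraph V} {F : Finset (List V)} {A : Set V} [DecidableEq V]

/-- `f` sends every vertex of `A` to its cyclic successor in the member of `F` containing it. -/
def IsSucc (F : Finset (List V)) (A : Set V) (f : V → V) : Prop :=
  ∀ y ∈ A, ∀ l ∈ F, ∀ hy : y ∈ l, f y = l.next y hy

variable {f : V → V}

theorem IsSucc.succ_mem (hf : IsSucc F A f) {l : List V} (hl : l ∈ F) {y : V} (hy : y ∈ A)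
    (hyl : y ∈ l) : f y ∈ l := by
  rw [hf y hy l hl hyl]
  exact List.next_mem _ _ _

namespace IsMaximalSys

theorem seg_closed (hF : IsMaximalSys G F) (hf : IsSucc F A f)
    {l : List V} (hl : l ∈ F) (hc : ClosedList G l) {y : V} (hy : y ∈ A)
    (hyl : y ∈ l) : Seg G (f y) y l := by
  rw [hf y hy l hl hyl]
  exact exists_seg_of_closed (hF.list_nodup hl) (hF.chain l hl) hc hyl

theorem seg_open (hF : IsMaximalSys G F) (hA : IsAttached G F A) (hf : IsSucc F A f)
    {l : List V} (hl : l ∈ F) (hc : ¬ ClosedList G l) {a b : V}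
    (ha : l.head? = some a) (hb : l.getLast? = some b) {y : V} (hy : y ∈ A) (hyl : y ∈ l) :
    ∃ p q, Seg G a y p ∧ Seg G (f y) b q ∧ p + q = (l : Multiset V) := by
  rw [hf y hy l hl hyl]
  refine exists_seg_split (hF.list_nodup hl) (hF.chain l hl) ha hb hyl ?_
  rintro rfl
  exact (hF.ends_notMem hl hc hA ha hb).2 hy

theorem seg_open_two (hF : IsMaximalSys G F) (hA : IsAttached G F A) (hf : IsSucc F A f)
    {l : List V} (hl : l ∈ F) (hc : ¬ ClosedList G l) {a b : V}
    (ha : l.head? = some a) (hb : l.getLast? = some b) {y y' : V} (hy : y ∈ A) (hyl : y ∈ l)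
    (hy' : y' ∈ A) (hyl' : y' ∈ l) (hne : y ≠ y') :
    (∃ p q r, Seg G a y p ∧ Seg G (f y) y' q ∧ Seg G (f y') b r ∧ p + q + r = (l : Multiset V)) ∨
    (∃ p q r, Seg G a y' p ∧ Seg G (f y') y q ∧ Seg G (f y) b r ∧
      p + q + r = (l : Multiset V)) := by
  rw [hf y hy l hl hyl, hf y' hy' l hl hyl']
  have hb' := (hF.ends_notMem hl hc hA ha hb).2
  refine exists_seg_split_two (hF.list_nodup hl) (hF.chain l hl) ha hb hyl ?_ hyl' ?_ hne
  · rintro rfl; exact hb' hy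
  · rintro rfl; exact hb' hy'

theorem seg_closed_two (hF : IsMaximalSys G F) (hf : IsSucc F A f)
    {l : List V} (hl : l ∈ F) (hc : ClosedList G l) {y y' : V} (hy : y ∈ A)
    (hyl : y ∈ l) (hy' : y' ∈ A) (hyl' : y' ∈ l) (hne : y ≠ y') :
    ∃ p q, Seg G (f y) y' p ∧ Seg G (f y') y q ∧ p + q = (l : Multiset V) := by
  rw [hf y hy l hl hyl, hf y' hy' l hl hyl']
  exact exists_seg_split_two_of_closed (hF.list_nodup hl) (hF.chain l hl) hc hyl hyl' hne

theorem succ_notMem (hF : IsMaximalSys G F) (hA : IsAttached G F A) (hf : IsSucc F A f)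
    {y : V} (hy : y ∈ A) : f y ∉ A := by
  intro hz
  obtain ⟨l, hl, hyl⟩ := mem_coverOf.1 (hA.mem_cover y hy)
  obtain ⟨h, h', q, h1, h2, h3, h4⟩ := hA.link y hy (f y) hz
  by_cases hc : ClosedList G l
  · have hs := hF.seg_closed hf hl hc hy hyl
    exact hF.no_sys_one hl h3.ne_zero h4 ((hs.join h1 h3).sys_closed (Or.inr h2.symm)) rfl
      (one_le_wt l)
  · obtain ⟨a, b, ha, hb⟩ := exists_ends (hF.ne_nil l hl)
    obtain ⟨p, r, hp, hr, e⟩ := hF.seg_open hA hf hl hc ha hb hy hyl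
    refine hF.no_sys_one hl h3.ne_zero h4 ((hp.join h1 h3).join h2 hr).sys ?_
      (wt_of_not_closed hc).ge
    rw [← e]; abel

theorem succ_injOn (hF : IsMaximalSys G F) (hf : IsSucc F A f)
    (hA : ∀ y ∈ A, y ∈ coverOf F) : Set.InjOn f A := by
  intro y hy y' hy' h
  obtain ⟨l, hl, hyl⟩ := mem_coverOf.1 (hA y hy)
  obtain ⟨l', hl', hyl'⟩ := mem_coverOf.1 (hA y' hy')
  obtain rfl := hF.eq_of_mem hl hl' (hf.succ_mem hl hy hyl)
    (h ▸ hf.succ_mem hl' hy' hyl')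
  rw [hf y hy l hl hyl, hf y' hy' l hl hyl'] at h
  exact List.next_injective (hF.list_nodup hl) hyl hyl' h

theorem succ_not_adj (hF : IsMaximalSys G F) (hA : IsAttached G F A) (hf : IsSucc F A f)
    {y y' : V} (hy : y ∈ A) (hy' : y' ∈ A) (hne : y ≠ y') :
    ¬ G.Adj (f y) (f y') := by
  intro hadj
  obtain ⟨l, hl, hyl⟩ := mem_coverOf.1 (hA.mem_cover y hy)
  obtain ⟨l', hl', hyl'⟩ := mem_coverOf.1 (hA.mem_cover y' hy')
  obtain ⟨h, h', q, h1, h2, h3, h4⟩ := hA.link y hy y' hy'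
  have hq := h3.ne_zero
  obtain ⟨a, b, ha, hb⟩ := exists_ends (hF.ne_nil l hl)
  obtain ⟨c, d, hc, hd⟩ := exists_ends (hF.ne_nil l' hl')
  by_cases hll : l = l'
  · subst hll
    by_cases hcl : ClosedList G l
    · obtain ⟨p, r, hp, hr, e⟩ := hF.seg_closed_two hf hl hcl hy hyl hy' hyl' hne
      refine hF.no_sys_one hl hq h4 (((hr.join h1 h3).join h2 hp.symm).sys_closed
        (Or.inr hadj.symm)) ?_ (one_le_wt l)
      rw [← e]; abel
    · rcases hF.seg_open_two hA hf hl hcl ha hb hy hyl hy' hyl' hne with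
        ⟨p, r, s, hp, hr, hs, e⟩ | ⟨p, r, s, hp, hr, hs, e⟩
      · refine hF.no_sys_one hl hq h4
          (((hp.join h1 h3).join h2 hr.symm).join hadj hs).sys ?_ (wt_of_not_closed hcl).ge
        rw [← e]; abel
      · refine hF.no_sys_one hl hq h4
          (((hp.join h2.symm h3.symm).join h1.symm hr.symm).join hadj.symm hs).sys ?_
          (wt_of_not_closed hcl).ge
        rw [← e]; abel
  · by_cases hcl : ClosedList G l <;> by_cases hcl' : ClosedList G l'
    · have hs := hF.seg_closed hf hl hcl hy hyl
      have hs' := hF.seg_closed hf hl' hcl' hy' hyl'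
      refine hF.no_sys_two hl hl' hll hq h4 ((hs.join h1 h3).join h2 hs'.symm).sys ?_ ?_
      · abel
      · rw [wt_of_closed hcl, wt_of_closed hcl']
    · have hs := hF.seg_closed hf hl hcl hy hyl
      obtain ⟨p, r, hp, hr, e⟩ := hF.seg_open hA hf hl' hcl' hc hd hy' hyl'
      refine hF.no_sys_two hl hl' hll hq h4
        (((hp.join h2.symm h3.symm).join h1.symm hs.symm).join hadj hr).sys ?_ ?_
      · rw [← e]; abel
      · rw [wt_of_not_closed hcl']; omega
    · have hs := hF.seg_closed hf hl' hcl' hy' hyl'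
      obtain ⟨p, r, hp, hr, e⟩ := hF.seg_open hA hf hl hcl ha hb hy hyl
      refine hF.no_sys_two hl hl' hll hq h4
        (((hp.join h1 h3).join h2 hs.symm).join hadj.symm hr).sys ?_ ?_
      · rw [← e]; abel
      · rw [wt_of_not_closed hcl]; omega
    · obtain ⟨p, r, hp, hr, e⟩ := hF.seg_open hA hf hl hcl ha hb hy hyl
      obtain ⟨p', r', hp', hr', e'⟩ := hF.seg_open hA hf hl' hcl' hc hd hy' hyl'
      refine hF.no_sys_two hl hl' hll hq h4
        (((hp.join h1 h3).join h2 hp'.symm).sys.add (hr.symm.join hadj hr').sys) ?_ ?_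
      · rw [← e, ← e']; abel
      · rw [wt_of_not_closed hcl, wt_of_not_closed hcl']

theorem rep_not_adj (hF : IsMaximalSys G F)
    {l l' : List V} {r r' h : V} (hh : (coverOf F + {h}).Nodup) (hl : l ∈ F)
    (hl' : l' ∈ F) (hr : IsRep G A l r) (hr' : IsRep G A l' r') (hne : r ≠ r')
    (hll : l = l' → ¬ ClosedList G l) : ¬ G.Adj r r' := by
  intro hadj
  by_cases e : l = l'
  · subst e
    have hc := hll rfl
    rcases hr.isEnd hc with h1 | h1 <;> rcases hr'.isEnd hc with h2 | h2
    · rw [h1] at h2; cases h2; exact hne rfl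
    · exact (ends_of_not_closed hc h1 h2).2 hadj
    · exact (ends_of_not_closed hc h2 h1).2 hadj.symm
    · rw [h1] at h2; cases h2; exact hne rfl
  · by_cases hcc : ClosedList G l ∧ ClosedList G l'
    · exact hF.closed_not_adj l hl l' hl' e hcc.1 hcc.2 r hr.mem r' hr'.mem hadj
    · obtain ⟨c, hs⟩ := hr.exists_seg hF hl
      obtain ⟨c', hs'⟩ := hr'.exists_seg hF hl'
      refine hF.no_sys_two hl hl' e (by simp) hh
        ((hs.join hadj hs'.symm).sys.add ((Seg.single h).sys_closed (Or.inl rfl))) rfl ?_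
      have := one_le_wt (G := G) l
      have := one_le_wt (G := G) l'
      by_cases hc : ClosedList G l
      · rw [wt_of_not_closed (l := l') (fun h => hcc ⟨hc, h⟩)]; omega
      · rw [wt_of_not_closed hc]; omega

theorem conflict_cases (hF : IsMaximalSys G F) (hA : IsAttached G F A) (hf : IsSucc F A f)
    {l l' : List V} {r y : V} (hl : l ∈ F) (hl' : l' ∈ F)
    (hr : IsRep G A l r) (hy : y ∈ A) (hyl : y ∈ l') (hc : r = f y ∨ G.Adj r (f y)) :
    (¬ ClosedList G l' ∧ l = l' ∧ l'.getLast? = some r) ∨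
    (¬ ClosedList G l' ∧ ClosedList G l ∧ G.Adj r (f y)) ∨ (l = l' ∧ ClosedList G l) := by
  obtain ⟨h, h1, h2⟩ := hA.exists_adj hy
  obtain ⟨a, b, ha, hb⟩ := exists_ends (hF.ne_nil l' hl')
  by_cases e : l = l'
  · subst e
    by_cases hcl : ClosedList G l
    · exact Or.inr (Or.inr ⟨rfl, hcl⟩)
    · refine Or.inl ⟨hcl, rfl, ?_⟩
      rcases hr.isEnd hcl with h3 | h3
      · exfalso
        rw [ha] at h3
        cases h3
        obtain ⟨p, q, hp, hq, e⟩ := hF.seg_open hA hf hl hcl ha hb hy hyl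
        rcases hc with hc | hc
        · have := Multiset.coe_nodup.2 (hF.list_nodup hl)
          rw [← e, Multiset.nodup_add] at this
          exact Multiset.disjoint_left.1 this.2.2 hp.left_mem (hc ▸ hq.left_mem)
        · refine hF.no_sys_one hl (by simp) h2 ((hq.symm.join hc.symm hp).snoc h1).sys ?_
            (wt_of_not_closed hcl).ge
          rw [← e]; abel
      · exact h3
  · have hadj : G.Adj r (f y) := by
      rcases hc with hc | hc
      · exact absurd (hF.eq_of_mem hl hl' hr.mem (hc ▸ hf.succ_mem hl' hy hyl)) e
      · exact hc
    obtain ⟨c, hs⟩ := hr.exists_seg hF hl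
    by_cases hcl' : ClosedList G l'
    · exfalso
      refine hF.no_sys_two hl hl' e (by simp) h2
        ((hs.join hadj (hF.seg_closed hf hl' hcl' hy hyl)).snoc h1).sys rfl ?_
      have := one_le_wt (G := G) l
      have := one_le_wt (G := G) l'
      omega
    · refine Or.inr (Or.inl ⟨hcl', ?_, hadj⟩)
      by_contra hcl
      obtain ⟨p, q, hp, hq, e'⟩ := hF.seg_open hA hf hl' hcl' ha hb hy hyl
      refine hF.no_sys_two hl hl' e (by simp) h2
        ((hp.snoc h1).sys.add (hs.join hadj hq).sys) ?_ ?_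
      · rw [← e']; abel
      · rw [wt_of_not_closed hcl, wt_of_not_closed hcl']

theorem exists_residual (hF : IsMaximalSys G F) (hA : IsAttached G F A) (hf : IsSucc F A f)
    {l l' : List V} {r y : V} (hl : l ∈ F) (hl' : l' ∈ F)
    (hr : IsRep G A l r) (hy : y ∈ A) (hyl : y ∈ l') (hc : r = f y ∨ G.Adj r (f y)) :
    ∃ c p m w, Seg G c y p ∧ Sys G m w ∧ coverOf {l, l'} = p + m ∧
      w + 1 = weightOf G {l, l'} := by
  obtain ⟨a, b, ha, hb⟩ := exists_ends (hF.ne_nil l' hl')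
  rcases hF.conflict_cases hA hf hl hl' hr hy hyl hc with
    ⟨ho, rfl, hlast⟩ | ⟨ho, hcl, hadj⟩ | ⟨rfl, hcl⟩
  · obtain ⟨p, q, hp, hq, e⟩ := hF.seg_open hA hf hl ho ha hlast hy hyl
    refine ⟨a, p, q, 1, hp, hq.sys_closed ?_, ?_, ?_⟩
    · exact hc.imp Eq.symm fun h => h.symm
    · simp [coverOf_singleton, e]
    · simp [weightOf_singleton, wt_of_not_closed ho]
  · have hne : l ≠ l' := by rintro rfl; exact ho hcl
    obtain ⟨p, q, hp, hq, e⟩ := hF.seg_open hA hf hl' ho ha hb hy hyl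
    obtain ⟨c, hs⟩ := hr.exists_seg hF hl
    refine ⟨a, p, l + q, 2, hp, (hs.join hadj hq).sys, ?_, ?_⟩
    · rw [coverOf_pair hne, ← e]; abel
    · rw [weightOf_pair hne, wt_of_not_closed ho, wt_of_closed hcl]
  · refine ⟨_, l, 0, 0, hF.seg_closed hf hl hcl hy hyl, sys_zero, ?_, ?_⟩
    · simp [coverOf_singleton]
    · simp [weightOf_singleton, wt_of_closed hcl]

theorem no_conflict_of_disjoint (hF : IsMaximalSys G F) (hA : IsAttached G F A) (hf : IsSucc F A f)
    {l l' k k' : List V} {r y s z : V} (hl : l ∈ F) (hl' : l' ∈ F)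
    (hk : k ∈ F) (hk' : k' ∈ F) (hr : IsRep G A l r) (hs : IsRep G A k s) (hy : y ∈ A)
    (hyl : y ∈ l') (hz : z ∈ A) (hzk : z ∈ k') (hc : r = f y ∨ G.Adj r (f y))
    (hd : s = f z ∨ G.Adj s (f z)) (hlk : l ≠ k) (hlk' : l ≠ k') (hl'k : l' ≠ k)
    (hl'k' : l' ≠ k') : False := by
  obtain ⟨c, p, m, w, hp, hm, e, hw⟩ := hF.exists_residual hA hf hl hl' hr hy hyl hc
  obtain ⟨d, p', m', w', hp', hm', e', hw'⟩ := hF.exists_residual hA hf hk hk' hs hz hzk hd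
  obtain ⟨h, h', q, h1, h2, h3, h4⟩ := hA.link y hy z hz
  have hdis : Disjoint ({l, l'} : Finset (List V)) {k, k'} := by
    simp [Finset.disjoint_left, hlk, hlk', hl'k, hl'k']
  refine hF.no_sys (E := {l, l'} ∪ {k, k'}) (by simp [Finset.insert_subset_iff, *])
    h3.ne_zero h4 ((((hp.join h1 h3).join h2 hp'.symm).sys.add hm).add hm') ?_ ?_
  · rw [coverOf, Finset.sum_union hdis, ← coverOf, ← coverOf, e, e']; abel
  · rw [weightOf, Finset.sum_union hdis, ← weightOf, ← weightOf]; omega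

theorem no_conflict_of_last (hF : IsMaximalSys G F) (hA : IsAttached G F A) (hf : IsSucc F A f)
    {P C : List V} {b y s z : V} (hP : P ∈ F)
    (hC : C ∈ F) (ho : ¬ ClosedList G P) (hcl : ClosedList G C) (hb : P.getLast? = some b)
    (hs : IsRep G A C s) (hy : y ∈ A)
    (hyl : y ∈ P) (hz : z ∈ A) (hzk : z ∈ P) (hc : b = f y ∨ G.Adj b (f y))
    (hd : G.Adj s (f z)) (hne : y ≠ z) : False := by
  have hPC : P ≠ C := by rintro rfl; exact ho hcl
  obtain ⟨a, -, ha, -⟩ := exists_ends (hF.ne_nil P hP)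
  obtain ⟨c, hs⟩ := hs.exists_seg hF hC
  obtain ⟨h, h', q, h1, h2, h3, h4⟩ := hA.link y hy z hz
  have hnd := Multiset.coe_nodup.2 (hF.list_nodup hP)
  rcases hF.seg_open_two hA hf hP ho ha hb hy hyl hz hzk hne with
    ⟨u, v, w, hu, hv, hw, e⟩ | ⟨u, v, w, hu, hv, hw, e⟩
  · have hadj : G.Adj b (f y) := by
      refine hc.resolve_left fun hbe => ?_
      rw [← e, Multiset.nodup_add, Multiset.nodup_add] at hnd
      exact Multiset.disjoint_left.1 hnd.2.2
        (Multiset.mem_add.2 (Or.inr hv.left_mem)) (hbe ▸ hw.right_mem)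
    refine hF.no_sys_two hP hC hPC h3.ne_zero h4
      (((((hu.join h1 h3).join h2 hv.symm).join hadj.symm hw.symm).join hd.symm hs.symm).sys) ?_ ?_
    · rw [← e]; abel
    · rw [wt_of_not_closed ho]; omega
  · refine hF.no_sys_two hP hC hPC h3.ne_zero h4
      ((((hu.join h2.symm h3.symm).join h1.symm hv.symm).join hd.symm hs.symm).sys.add
        (hw.sys_closed (hc.imp Eq.symm fun h => h.symm))) ?_ ?_
    · rw [← e]; abel
    · rw [wt_of_not_closed ho, wt_of_closed hcl]

theorem no_conflict_of_closed (hF : IsMaximalSys G F) (hA : IsAttached G F A) (hf : IsSucc F A f)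
    {P C D : List V} {r y s z : V} (hP : P ∈ F)
    (hC : C ∈ F) (hD : D ∈ F) (ho : ¬ ClosedList G P) (hcl : ClosedList G C)
    (hcl' : ClosedList G D) (hCD : C ≠ D) (hr : IsRep G A C r) (hs : IsRep G A D s) (hy : y ∈ A)
    (hyl : y ∈ P) (hz : z ∈ A) (hzk : z ∈ P) (hc : G.Adj r (f y))
    (hd : G.Adj s (f z)) (hne : y ≠ z) : False := by
  have hPC : P ≠ C := by rintro rfl; exact ho hcl
  have hPD : P ≠ D := by rintro rfl; exact ho hcl'
  obtain ⟨a, b, ha, hb⟩ := exists_ends (hF.ne_nil P hP)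
  obtain ⟨c, hr⟩ := hr.exists_seg hF hC
  obtain ⟨d, hs⟩ := hs.exists_seg hF hD
  obtain ⟨h, h', q, h1, h2, h3, h4⟩ := hA.link y hy z hz
  have hcov : coverOf {P, C, D} = (P + (C + D) : Multiset V) := by
    rw [← coverOf_pair hCD]
    exact Finset.sum_insert (by simp [hPC, hPD])
  have hwt : weightOf G {P, C, D} = 4 := by
    have : weightOf G {P, C, D} = wt G P + weightOf G {C, D} :=
      Finset.sum_insert (by simp [hPC, hPD])
    rw [this, weightOf_pair hCD, wt_of_not_closed ho, wt_of_closed hcl, wt_of_closed hcl']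
  have hsub : {P, C, D} ⊆ F := by simp [Finset.insert_subset_iff, *]
  rcases hF.seg_open_two hA hf hP ho ha hb hy hyl hz hzk hne with
    ⟨u, v, w, hu, hv, hw, e⟩ | ⟨u, v, w, hu, hv, hw, e⟩
  · refine hF.no_sys hsub h3.ne_zero h4
      ((((hu.join h1 h3).join h2 hv.symm).join hc.symm hr.symm).sys.add (hs.join hd hw).sys) ?_ ?_
    · rw [hcov, ← e]; abel
    · rw [hwt]
  · refine hF.no_sys hsub h3.ne_zero h4
      ((((hu.join h2.symm h3.symm).join h1.symm hv.symm).join hd.symm hs.symm).sys.add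
        (hr.join hc hw).sys) ?_ ?_
    · rw [hcov, ← e]; abel
    · rw [hwt]

/-- Any two conflicts between representatives and successors share a representative or a
successor. -/
theorem eq_or_eq_of_conflict (hF : IsMaximalSys G F) (hA : IsAttached G F A) (hf : IsSucc F A f)
    {l k : List V} {r y s z : V} (hl : l ∈ F) (hk : k ∈ F)
    (hr : IsRep G A l r) (hs : IsRep G A k s) (hy : y ∈ A) (hz : z ∈ A)
    (hc : r = f y ∨ G.Adj r (f y)) (hd : s = f z ∨ G.Adj s (f z))
    (hlk : r ≠ s → l = k → ¬ ClosedList G l) : r = s ∨ y = z := by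
  by_contra! hne
  obtain ⟨l', hl', hyl⟩ := mem_coverOf.1 (hA.mem_cover y hy)
  obtain ⟨k', hk', hzk⟩ := mem_coverOf.1 (hA.mem_cover z hz)
  have key := hF.no_conflict_of_disjoint hA hf hl hl' hk hk' hr hs hy hyl hz hzk hc hd
  have hlk := hlk hne.1
  rcases hF.conflict_cases hA hf hl hl' hr hy hyl hc with
    ⟨ho, rfl, hlast⟩ | ⟨ho, hcl, hadj⟩ | ⟨rfl, hcl⟩ <;>
  rcases hF.conflict_cases hA hf hk hk' hs hz hzk hd with
    ⟨ho', rfl, hlast'⟩ | ⟨ho', hcl', hadj'⟩ | ⟨rfl, hcl'⟩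
  · by_cases e : l = k
    · subst e
      rw [hlast] at hlast'
      cases hlast'
      exact hne.1 rfl
    · exact key e e e e
  · by_cases e : l = k'
    · subst e
      exact hF.no_conflict_of_last hA hf hl hk ho hcl' hlast hs hy hyl hz hzk hc hadj' hne.2
    · have : l ≠ k := by rintro rfl; exact ho hcl'
      exact key this e this e
  · have : l ≠ k := by rintro rfl; exact ho hcl'
    exact key this this this this
  · by_cases e : l' = k
    · subst e
      exact hF.no_conflict_of_last hA hf hk hl ho hcl hlast' hr hz hzk hy hyl hd hadj hne.2.symm
    · have : l ≠ k := by rintro rfl; exact ho' hcl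
      exact key this this e e
  · have h1 : l ≠ k := fun e => hlk e hcl
    by_cases e : l' = k'
    · subst e
      exact hF.no_conflict_of_closed hA hf hl' hl hk ho hcl hcl' h1 hr hs hy hyl hz hzk hadj hadj'
        hne.2
    · exact key h1 (by rintro rfl; exact ho' hcl) (by rintro rfl; exact ho hcl') e
  · have h1 : l ≠ k := fun e => hlk e hcl
    have h2 : l' ≠ k := by rintro rfl; exact ho hcl'
    exact key h1 h1 h2 h2
  · have h1 : l ≠ k := by rintro rfl; exact ho' hcl
    exact key h1 h1 h1 h1
  · have h1 : l ≠ k := fun e => hlk e hcl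
    have h2 : l ≠ k' := by rintro rfl; exact ho' hcl
    exact key h1 h2 h1 h2
  · have h1 : l ≠ k := fun e => hlk e hcl
    exact key h1 h1 h1 h1

end IsMaximalSys

end Successors

section Independent

variable {G : SimpleGraph V} [DecidableEq V]

theorem exists_indep_of_no_conflict {R Y : Finset V}
    (hR : ∀ r ∈ R, ∀ s ∈ R, r ≠ s → ¬ G.Adj r s) (hY : ∀ y ∈ Y, ∀ z ∈ Y, y ≠ z → ¬ G.Adj y z)
    (h : ∀ r ∈ R, ∀ y ∈ Y, ¬ (r = y ∨ G.Adj r y)) :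
    (∀ v ∈ R ∪ Y, ∀ w ∈ R ∪ Y, v ≠ w → ¬ G.Adj v w) ∧ (R ∪ Y).card = R.card + Y.card := by
  simp only [not_or] at h
  refine ⟨?_, Finset.card_union_of_disjoint
    (Finset.disjoint_left.2 fun v hv hw => (h v hv v hw).1 rfl)⟩
  simp only [Finset.mem_union]
  rintro v (hv | hv) w (hw | hw) hne
  · exact hR v hv w hw hne
  · exact (h v hv w hw).2
  · exact fun e => (h w hw v hv).2 e.symm
  · exact hY v hv w hw hne

/-- If the conflicts between two independent sets form a star, then their union contains an
independent set missing at most one of their vertices. -/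
theorem exists_indep_of_conflict {R Y : Finset V}
    (hR : ∀ r ∈ R, ∀ s ∈ R, r ≠ s → ¬ G.Adj r s) (hY : ∀ y ∈ Y, ∀ z ∈ Y, y ≠ z → ¬ G.Adj y z)
    (h : ∀ r ∈ R, ∀ s ∈ R, ∀ y ∈ Y, ∀ z ∈ Y, (r = y ∨ G.Adj r y) → (s = z ∨ G.Adj s z) →
      r = s ∨ y = z) :
    ∃ I ⊆ R ∪ Y, (∀ v ∈ I, ∀ w ∈ I, v ≠ w → ¬ G.Adj v w) ∧ R.card + Y.card ≤ I.card + 1 := by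
  by_cases h0 : ∃ r ∈ R, ∃ y ∈ Y, r = y ∨ G.Adj r y
  · obtain ⟨r, hr, y, hy, hc⟩ := h0
    by_cases h1 : ∀ s ∈ R, ∀ z ∈ Y, (s = z ∨ G.Adj s z) → s = r
    · have key := exists_indep_of_no_conflict (G := G) (R := R.erase r) (Y := Y)
        (fun v hv w hw => hR v (Finset.mem_of_mem_erase hv) w (Finset.mem_of_mem_erase hw)) hY
        (fun s hs z hz hd => (Finset.mem_erase.1 hs).1 (h1 s (Finset.mem_of_mem_erase hs) z hz hd))
      refine ⟨_, Finset.union_subset_union_left (Finset.erase_subset _ _), key.1, ?_⟩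
      have := Finset.card_erase_add_one hr
      have := key.2
      omega
    · push Not at h1
      obtain ⟨s, hs, z, hz, hd, hsr⟩ := h1
      obtain rfl := (h s hs r hr z hz y hy hd hc).resolve_left hsr
      have key := exists_indep_of_no_conflict (G := G) (R := R) (Y := Y.erase z) hR
        (fun v hv w hw => hY v (Finset.mem_of_mem_erase hv) w (Finset.mem_of_mem_erase hw))
        (fun t ht x hx he => by
          have hx' := Finset.mem_erase.1 hx
          have e1 := (h t ht s hs x hx'.2 z hz he hd).resolve_right hx'.1
          have e2 := (h t ht r hr x hx'.2 z hz he hc).resolve_right hx'.1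
          exact hsr (e1.symm.trans e2))
      refine ⟨_, Finset.union_subset_union_right (Finset.erase_subset _ _), key.1, ?_⟩
      have := Finset.card_erase_add_one hz
      have := key.2
      omega
  · push Not at h0
    have key := exists_indep_of_no_conflict hR hY
      (fun r hr y hy hc => hc.elim (h0 r hr y hy).1 (h0 r hr y hy).2)
    exact ⟨_, subset_rfl, key.1, by rw [key.2]; omega⟩

theorem exists_isSucc (F : Finset (List V)) (A : Set V)
    (h : ∀ l ∈ F, ∀ l' ∈ F, ∀ v ∈ l, v ∈ l' → l = l') :
    ∃ f, IsSucc F A f := by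
  have : ∀ y : V, ∃ z, ∀ l ∈ F, ∀ hy : y ∈ l, z = l.next y hy := by
    intro y
    by_cases hy : ∃ l ∈ F, y ∈ l
    · obtain ⟨l, hl, hyl⟩ := hy
      refine ⟨l.next y hyl, fun l' hl' hy' => ?_⟩
      obtain rfl := h l hl l' hl' y hyl hy'
      rfl
    · exact ⟨y, fun l hl hyl => absurd ⟨l, hl, hyl⟩ hy⟩
  choose f hf using this
  exact ⟨f, fun y _ => hf y⟩

theorem IsMaximalSys.exists_reps {F : Finset (List V)} {A : Set V} {f : V → V}
    (hF : IsMaximalSys G F)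
    (hA : IsAttached G F A) (hf : IsSucc F A f) {l : List V} (hl : l ∈ F) :
    ∃ s : Finset V, s.card = wt G l ∧ ∀ r ∈ s, IsRep G A l r := by
  obtain ⟨a, b, ha, hb⟩ := exists_ends (hF.ne_nil l hl)
  by_cases hc : ClosedList G l
  · rw [wt_of_closed hc]
    by_cases h : ∃ y ∈ A, y ∈ l
    · obtain ⟨y, hy, hyl⟩ := h
      refine ⟨{f y}, by simp, ?_⟩
      simp only [Finset.mem_singleton, forall_eq]
      exact ⟨hf.succ_mem hl hy hyl, hF.succ_notMem hA hf hy, fun h => absurd hc h⟩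
    · push Not at h
      refine ⟨{a}, by simp, ?_⟩
      have hal := List.mem_of_mem_head? ha
      simp only [Finset.mem_singleton, forall_eq]
      exact ⟨hal, fun h' => h a h' hal, fun h => absurd hc h⟩
  · rw [wt_of_not_closed hc]
    have hends := hF.ends_notMem hl hc hA ha hb
    refine ⟨{a, b}, Finset.card_pair (ends_of_not_closed hc ha hb).1, ?_⟩
    simp only [Finset.mem_insert, Finset.mem_singleton, forall_eq_or_imp, forall_eq]
    exact ⟨⟨List.mem_of_mem_head? ha, hends.1, fun _ => Or.inl ha⟩,
      ⟨List.mem_of_getLast? hb, hends.2, fun _ => Or.inr hb⟩⟩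

theorem IsMaximalSys.exists_indep {F : Finset (List V)} {A : Finset V} (hF : IsMaximalSys G F)
    (hA : IsAttached G F (A : Set V)) {h : V} (hh : h ∉ coverOf F)
    (hAdj : ∀ v ∈ coverOf F, G.Adj h v → v ∈ A) :
    ∃ I : Finset V, (∀ v ∈ I, ∀ w ∈ I, v ≠ w → ¬ G.Adj v w) ∧ weightOf G F + A.card ≤ I.card := by
  obtain ⟨f, hf⟩ := exists_isSucc F (A : Set V) fun l hl l' hl' v hv hv' =>
    hF.eq_of_mem hl hl' hv hv'
  have hhn : (coverOf F + {h}).Nodup := by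
    rw [Multiset.nodup_add]
    exact ⟨hF.nodup, Multiset.nodup_singleton h, by simpa using hh⟩
  have hrep : ∀ l, ∃ s : Finset V, l ∈ F → s.card = wt G l ∧ ∀ r ∈ s, IsRep G A l r := by
    intro l
    by_cases hl : l ∈ F
    · obtain ⟨s, hs⟩ := hF.exists_reps hA hf hl
      exact ⟨s, fun _ => hs⟩
    · exact ⟨∅, fun h => absurd h hl⟩
  choose ρ hρ using hrep
  have hone : ∀ l ∈ F, ∀ r ∈ ρ l, ∀ s ∈ ρ l, r ≠ s → ¬ ClosedList G l := by
    intro l hl r hr s hs hne hc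
    have := (hρ l hl).1
    rw [wt_of_closed hc] at this
    exact hne (Finset.card_le_one.1 this.le r hr s hs)
  have hcard : (F.biUnion ρ).card = weightOf G F := by
    rw [Finset.card_biUnion, weightOf]
    · exact Finset.sum_congr rfl fun l hl => (hρ l hl).1
    · intro l hl l' hl' hne
      refine Finset.disjoint_left.2 fun v hv hv' => hne ?_
      exact hF.eq_of_mem hl hl' ((hρ l hl).2 v hv).mem ((hρ l' hl').2 v hv').mem
  obtain ⟨I, hI, hind, hle⟩ := exists_indep_of_conflict (G := G) (R := F.biUnion ρ)
      (Y := A.image f) (by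
        simp only [Finset.mem_biUnion]
        rintro r ⟨l, hl, hr⟩ s ⟨l', hl', hs⟩ hne
        refine hF.rep_not_adj hhn hl hl' ((hρ l hl).2 r hr) ((hρ l' hl').2 s hs) hne ?_
        rintro rfl
        exact hone l hl r hr s hs hne) (by
        simp only [Finset.mem_image]
        rintro _ ⟨y, hy, rfl⟩ _ ⟨z, hz, rfl⟩ hne
        exact hF.succ_not_adj hA hf hy hz fun e => hne (congrArg f e)) (by
        simp only [Finset.mem_biUnion, Finset.mem_image]
        rintro r ⟨l, hl, hr⟩ s ⟨l', hl', hs⟩ _ ⟨y, hy, rfl⟩ _ ⟨z, hz, rfl⟩ hc hd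
        refine (hF.eq_or_eq_of_conflict hA hf hl hl' ((hρ l hl).2 r hr) ((hρ l' hl').2 s hs)
          hy hz hc hd ?_).imp_right (congrArg f)
        rintro hne rfl
        exact hone l hl r hr s hs hne)
  have hcov : ∀ v ∈ I, v ∈ coverOf F ∧ v ∉ A := by
    intro v hv
    have := hI hv
    simp only [Finset.mem_union, Finset.mem_biUnion, Finset.mem_image] at this
    rcases this with ⟨l, hl, hr⟩ | ⟨y, hy, rfl⟩
    · have := (hρ l hl).2 v hr
      exact ⟨mem_coverOf.2 ⟨l, hl, this.mem⟩, by simpa using this.notMem⟩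
    · obtain ⟨l, hl, hyl⟩ := mem_coverOf.1 (hA.mem_cover y hy)
      exact ⟨mem_coverOf.2 ⟨l, hl, hf.succ_mem hl hy hyl⟩, by
        simpa using hF.succ_notMem hA hf hy⟩
  have hno : ∀ v ∈ I, ¬ G.Adj h v := fun v hv e => (hcov v hv).2 (hAdj v (hcov v hv).1 e)
  refine ⟨insert h I, ?_, ?_⟩
  · simp only [Finset.mem_insert]
    rintro v (rfl | hv) w (rfl | hw) hne
    · exact absurd rfl hne
    · exact hno w hw
    · exact fun e => hno v hv e.symm
    · exact hind v hv w hw hne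
  · rw [Finset.card_insert_of_notMem fun h' => hh (hcov h h').1]
    rw [hcard, Finset.card_image_of_injOn (hF.succ_injOn hf hA.mem_cover)] at hle
    exact hle

end Independent

section Existence

variable {G : SimpleGraph V}

theorem Sys.exists_finset {m : Multiset V} {w : ℕ} (h : Sys G m w) (hm : m.Nodup) :
    ∃ F : Finset (List V), (∀ l ∈ F, l ≠ [] ∧ l.IsChain G.Adj) ∧ coverOf F = m ∧
      weightOf G F ≤ w := by
  obtain ⟨S, h1, rfl, h3⟩ := h
  have hS : S.Nodup := by
    rw [Multiset.nodup_iff_ne_cons_cons]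
    rintro l t rfl
    rw [Multiset.map_cons, Multiset.map_cons, Multiset.sum_cons, Multiset.sum_cons, ← add_assoc]
      at hm
    have := (Multiset.nodup_add.1 (Multiset.nodup_add.1 hm).1).2.2
    obtain ⟨a, ha⟩ := List.exists_mem_of_ne_nil l (h1 l (by simp)).1
    exact Multiset.disjoint_left.1 this (by simpa using ha) (by simpa using ha)
  exact ⟨⟨S, hS⟩, h1, rfl, h3⟩

theorem exists_seg_of_reachable {s : Set V} {u v : s} (h : (G.induce s).Reachable u v) :
    ∃ q, Seg G (u : V) v q ∧ q.Nodup ∧ ∀ x ∈ q, x ∈ s := by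
  classical
  obtain ⟨p⟩ := h
  have hp := p.toPath.2
  set w := p.toPath.1
  refine ⟨(w.support.map Subtype.val : List V), seg_of_list ?_ ?_ ?_, ?_, ?_⟩
  · rw [List.head?_map, List.head?_eq_some_head w.support_ne_nil, w.head_support]; rfl
  · rw [List.getLast?_map, List.getLast?_eq_some_getLast w.support_ne_nil, w.getLast_support]; rfl
  · rw [List.isChain_map]
    exact w.isChain_adj_support
  · exact Multiset.coe_nodup.2 (hp.support_nodup.map Subtype.val_injective)
  · simp only [Multiset.mem_coe, List.mem_map]
    rintro _ ⟨x, -, rfl⟩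
    exact x.2

theorem vertexConn_spec [Fintype V] [Nonempty V] (G : SimpleGraph V) (X : Finset V)
    (hX : X.card < vertexConn G) : (G.induce ((↑X : Set V)ᶜ)).Connected := by
  have : vertexConn G ∈ {k | k < Fintype.card V ∧ ∀ X : Finset V, X.card < k →
      (G.induce ((↑X : Set V)ᶜ)).Connected} :=
    Nat.sSup_mem ⟨0, Fintype.card_pos, by simp⟩ ⟨Fintype.card V, fun k hk => hk.1.le⟩
  exact this.2 X hX

theorem mem_of_reachable {H : Set V} (hH : ∀ u ∈ H, ∀ v, G.Adj u v → v ∈ H) {u v : V}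
    (h : G.Reachable u v) (hu : u ∈ H) : v ∈ H := by
  obtain ⟨p⟩ := h
  induction p with
  | nil => exact hu
  | cons hadj _ ih => exact ih (hH _ hu _ hadj)

theorem card_le_indepNumOn [Fintype V] (I : Finset V) (h : ∀ v ∈ I, ∀ w ∈ I, v ≠ w → ¬ G.Adj v w) :
    I.card ≤ indepNumOn G Set.univ := by
  refine le_csSup ⟨Fintype.card V, ?_⟩ ⟨I, subset_univ _, fun v hv w hw => h v hv w hw,
    Set.ncard_coe_finset I⟩
  rintro _ ⟨J, -, -, rfl⟩
  rw [← Nat.card_eq_fintype_card]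
  exact Set.ncard_le_card J

theorem exists_isMaximalSys [DecidableEq V] [Fintype V] (k : ℕ) :
    ∃ F : Finset (List V), IsMaximalSys G F ∧ weightOf G F ≤ k ∧
      ∀ v, v ∉ coverOf F → weightOf G F = k := by
  let T : Set (Finset (List V)) := {F | (∀ l ∈ F, l ≠ [] ∧ l.IsChain G.Adj) ∧
    (coverOf F).Nodup ∧ weightOf G F ≤ k}
  let φ : Finset (List V) → ℕ ×ₗ ℕ := fun F =>
    toLex (Fintype.card V - (coverOf F).card, F.card)
  have hT : T.Nonempty := ⟨∅, by simp [T, coverOf, weightOf]⟩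
  obtain ⟨F, hFT, hmin⟩ := (InvImage.wf φ wellFounded_lt).has_min T hT
  obtain ⟨hF, hnd, hw⟩ := hFT
  have hmax : ∀ q ≠ 0, (coverOf F + q).Nodup → ¬ Sys G (coverOf F + q) k := by
    intro q hq hn hs
    obtain ⟨F', h1, h2, h3⟩ := hs.exists_finset hn
    refine hmin F' ⟨h1, h2 ▸ hn, h3⟩ (Prod.Lex.toLex_lt_toLex.2 (Or.inl ?_))
    have h4 : (coverOf F + q).card ≤ Fintype.card V :=
      Finset.card_le_univ ⟨_, hn⟩
    have h5 := Multiset.card_pos.2 hq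
    rw [Multiset.card_add] at h4
    simp only [h2, Multiset.card_add]
    omega
  have hsys := sys_cover (G := G) (fun l hl => (hF l hl).1) fun l hl => (hF l hl).2
  refine ⟨F, ⟨fun l hl => (hF l hl).1, fun l hl => (hF l hl).2, hnd,
    fun q hq hn hs => hmax q hq hn (hs.mono hw), ?_⟩, hw, ?_⟩
  · intro l hl l' hl' hne hc hc' v hv v' hv' hadj
    have hle := coverOf_le (E := {l, l'}) (F := F) (by simp [Finset.insert_subset_iff, hl, hl'])
    rw [coverOf_pair hne] at hle
    have hnd' := Multiset.nodup_add.1 (Multiset.nodup_of_le hle hnd)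
    have hs := exists_seg_of_closed (Multiset.coe_nodup.1 hnd'.1) (hF l hl).2 hc hv
    have hs' := exists_seg_of_closed (Multiset.coe_nodup.1 hnd'.2.1) (hF l' hl').2 hc' hv'
    obtain ⟨p, hp1, -, hp3, hp4⟩ := hs.join hadj hs'.symm
    have hsub : {l, l'} ⊆ F := by simp [Finset.insert_subset_iff, hl, hl']
    have hpF : p ∉ F \ {l, l'} := by
      intro hp
      have hdisj : (coverOf (F \ {l, l'}) + coverOf {l, l'}).Nodup := by
        rw [coverOf, coverOf, Finset.sum_sdiff hsub]; exact hnd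
      refine Multiset.disjoint_left.1 (Multiset.nodup_add.1 hdisj).2.2
        (mem_coverOf.2 ⟨p, hp, ?_⟩) (mem_coverOf.2 ⟨l, by simp, hv⟩)
      rw [← Multiset.mem_coe, hp4]
      simp [hv]
    have hcov : coverOf (insert p (F \ {l, l'})) = coverOf F := by
      rw [coverOf, Finset.sum_insert hpF, hp4, ← coverOf_pair hne, add_comm]
      exact Finset.sum_sdiff hsub
    have hwt : weightOf G (insert p (F \ {l, l'})) ≤ weightOf G F := by
      have h1 : weightOf G (F \ {l, l'}) + weightOf G {l, l'} = weightOf G F :=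
        Finset.sum_sdiff hsub
      have h2 := weightOf_pair (G := G) hne
      rw [wt_of_closed hc, wt_of_closed hc'] at h2
      rw [weightOf, Finset.sum_insert hpF, ← weightOf]
      have := wt_le_two (G := G) p
      omega
    refine hmin (insert p (F \ {l, l'})) ⟨?_, hcov ▸ hnd, hwt.trans hw⟩
      (Prod.Lex.toLex_lt_toLex.2 (Or.inr ⟨by rw [hcov], ?_⟩))
    · simp only [Finset.mem_insert, forall_eq_or_imp]
      refine ⟨⟨?_, hp3⟩, fun q hq => hF q (Finset.mem_sdiff.1 hq).1⟩
      rintro rfl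
      simp at hp1
    · have h1 := Finset.card_sdiff_add_card_eq_card hsub
      rw [Finset.card_pair hne] at h1
      simp only [Finset.card_insert_of_notMem hpF]
      omega
  · intro v hv
    by_contra hlt
    refine hmax {v} (by simp) ?_ ((hsys.add
      ((Seg.single v).sys_closed (Or.inl rfl))).mono (by omega))
    rw [Multiset.nodup_add]
    exact ⟨hnd, Multiset.nodup_singleton v, by simpa using hv⟩

/-- Under Win's condition a maximal system of weight at most `k` is spanning. -/
theorem exists_spanning_sys [Fintype V] [Nonempty V] {k : ℕ} (hk : 1 ≤ k)
    (hακ : indepNumOn G Set.univ + 1 ≤ k + vertexConn G) :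
    ∃ F : Finset (List V), IsMaximalSys G F ∧ weightOf G F ≤ k ∧ ∀ v, v ∈ coverOf F := by
  classical
  obtain ⟨F, hF, hw, hwk⟩ := exists_isMaximalSys (G := G) k
  refine ⟨F, hF, hw, ?_⟩
  by_contra! ⟨h, hh⟩
  have hw := hwk h hh
  let s : Set V := {v | v ∉ coverOf F}
  let H : Set V := {v | ∃ hv : v ∈ s, (G.induce s).Reachable ⟨h, hh⟩ ⟨v, hv⟩}
  let A : Finset V := {v | v ∈ coverOf F ∧ ∃ u ∈ H, G.Adj v u}
  have hA : IsAttached G F (A : Set V) := by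
    refine ⟨fun y hy => by simp [A] at hy; exact hy.1, ?_⟩
    intro y hy y' hy'
    simp only [A, Finset.coe_filter, Finset.mem_univ, true_and, mem_ofPred_eq] at hy hy'
    obtain ⟨-, u, ⟨hu, hru⟩, hadj⟩ := hy
    obtain ⟨-, u', ⟨hu', hru'⟩, hadj'⟩ := hy'
    obtain ⟨q, hq, hqn, hqs⟩ := exists_seg_of_reachable (hru.symm.trans hru')
    refine ⟨u, u', q, hadj, hadj'.symm, hq, Multiset.nodup_add.2 ⟨hF.nodup, hqn, ?_⟩⟩
    exact Multiset.disjoint_left.2 fun hv hv' => hqs _ hv' hv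
  have hHs : ∀ v ∈ H, v ∉ coverOf F := fun v hv => hv.1
  have hhH : h ∈ H := ⟨hh, Reachable.refl _⟩
  have hclosed : ∀ u ∈ H, ∀ v, G.Adj u v → v ∉ A → v ∈ H := by
    rintro u hu v hadj hvA
    have hv : v ∈ s := fun hv => hvA (by simpa [A] using ⟨hv, u, hu, hadj.symm⟩)
    obtain ⟨hus, hr⟩ := hu
    refine ⟨hv, hr.trans (Adj.reachable ?_)⟩
    exact hadj
  obtain ⟨I, hI, hIc⟩ := hF.exists_indep hA hh fun v hv hadj => by
    simpa [A] using ⟨hv, h, hhH, hadj.symm⟩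
  have hIα := card_le_indepNumOn I hI
  have hAκ : A.card < vertexConn G := by omega
  have hconn := vertexConn_spec G A hAκ
  obtain ⟨w, hwF, hwA⟩ : ∃ w ∈ coverOf F, w ∉ A := by
    obtain ⟨l, hl⟩ : F.Nonempty := by
      rw [Finset.nonempty_iff_ne_empty]
      rintro rfl
      simp [weightOf] at hw
      omega
    obtain ⟨v, hv⟩ := List.exists_mem_of_ne_nil l (hF.ne_nil l hl)
    by_cases hvA : v ∈ A
    · obtain ⟨f, hf⟩ := exists_isSucc F (A : Set V) fun l hl l' hl' v hv hv' =>
        hF.eq_of_mem hl hl' hv hv'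
      exact ⟨f v, mem_coverOf.2 ⟨l, hl, hf.succ_mem hl hvA hv⟩,
        by simpa using hF.succ_notMem hA hf hvA⟩
    · exact ⟨v, mem_coverOf.2 ⟨l, hl, hv⟩, hvA⟩
  have hhA : h ∉ A := fun h' => hh (hA.mem_cover h h')
  have hr := hconn.preconnected ⟨h, by simpa using hhA⟩ ⟨w, by simpa using hwA⟩
  have : w ∈ H := mem_of_reachable (H := Subtype.val ⁻¹' H)
    (fun u hu v hadj => hclosed _ hu _ hadj v.2) hr hhH
  exact hHs w this hwF

end Existence

section Trees

variable {G : SimpleGraph V}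

/-- `G` contains a tree with vertex set `S` all of whose leaves are in `L`. -/
def HasTree (G : SimpleGraph V) (S L : Set V) : Prop :=
  ∃ T ≤ G, T.IsAcyclic ∧ (∀ u ∈ S, ∀ v ∈ S, T.Reachable u v) ∧ (∀ u v, T.Adj u v → u ∈ S) ∧
    ∀ v, (T.neighborSet v).ncard = 1 → v ∈ L

theorem hasTree_singleton (G : SimpleGraph V) (v : V) (L : Set V) : HasTree G {v} L := by
  refine ⟨⊥, bot_le, isAcyclic_bot, ?_, by simp, fun u hu => ?_⟩
  · rintro _ rfl _ rfl
    exact Reachable.refl _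
  · simp at hu

theorem HasTree.insert_vertex {S L L' : Set V} (h : HasTree G S L) {t v : V} (ht : t ∈ S)
    (hv : v ∉ S)
    (hadj : G.Adj t v) (hL : ∀ x ∈ L, x ≠ t → x ∈ L') (hvL : v ∈ L')
    (htL : S.Nontrivial ∨ t ∈ L') : HasTree G (insert v S) L' := by
  obtain ⟨T, hle, hac, hr, hS, hl⟩ := h
  have hne : t ≠ v := by rintro rfl; exact hv ht
  have hnr : ¬ T.Reachable t v := fun h =>
    hv (mem_of_reachable (fun u _ w h => hS w u h.symm) h ht)
  have hadj' : (T ⊔ edge t v).Adj t v := Or.inr ((edge_adj ..).2 ⟨Or.inl ⟨rfl, rfl⟩, hne⟩)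
  have hle' : T ≤ T ⊔ edge t v := le_sup_left
  have hrt : ∀ u ∈ insert v S, (T ⊔ edge t v).Reachable t u := by
    rintro u (rfl | hu)
    · exact hadj'.reachable
    · exact (hr t ht u hu).mono hle'
  refine ⟨T ⊔ edge t v, sup_le hle ((edge_le_iff ..).2 (Or.inr hadj)),
    hac.sup_edge_of_not_reachable hnr, fun u hu w hw => (hrt u hu).symm.trans (hrt w hw), ?_, ?_⟩
  · rintro u w (h | h)
    · exact Or.inr (hS u w h)
    · rcases ((edge_adj ..).1 h).1 with ⟨rfl, -⟩ | ⟨rfl, -⟩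
      · exact Or.inr ht
      · exact Or.inl rfl
  · intro u hu
    by_cases huv : u = v
    · exact huv ▸ hvL
    by_cases hut : u = t
    · subst hut
      refine htL.elim (fun hnt => ?_) id
      obtain ⟨w, hw, hwu⟩ := hnt.exists_ne u
      obtain ⟨x, hx⟩ : ∃ x, T.Adj u x := by
        obtain ⟨p⟩ := hr u ht w hw
        cases p with
        | nil => exact absurd rfl hwu
        | cons h _ => exact ⟨_, h⟩
      obtain ⟨z, hz⟩ := Set.ncard_eq_one.1 hu
      have h1 : x ∈ (T ⊔ edge u v).neighborSet u := Or.inl hx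
      have h2 : v ∈ (T ⊔ edge u v).neighborSet u := hadj'
      rw [hz] at h1 h2
      obtain rfl : x = v := h1.trans h2.symm
      exact absurd hx.reachable hnr
    · refine hL u (hl u ?_) hut
      convert hu using 2
      ext w
      simp [edge_adj, huv, hut]

theorem HasTree.extend {L' : Set V} {q : List V} : ∀ {S L : Set V} {t : V}, HasTree G S L →
    t ∈ S → q ≠ [] → (t :: q).IsChain G.Adj → q.Nodup → (∀ x ∈ q, x ∉ S) →
    (∀ x ∈ L, x ≠ t → x ∈ L') → (∀ b, q.getLast? = some b → b ∈ L') →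
    (S.Nontrivial ∨ t ∈ L') → HasTree G (S ∪ {x | x ∈ q}) L' := by
  induction q with
  | nil => intro S L t _ _ h; exact absurd rfl h
  | cons x q ih =>
    intro S L t h ht _ hch hnd hdis hL hlast htL
    rw [List.isChain_cons_cons] at hch
    by_cases hq : q = []
    · subst hq
      have := h.insert_vertex ht (hdis x (by simp)) hch.1 hL (hlast x (by simp)) htL
      convert this using 1
      ext; simp [or_comm]
    · have h1 := h.insert_vertex (L' := insert x L') ht (hdis x (by simp)) hch.1
        (fun y hy hyt => Or.inr (hL y hy hyt)) (Or.inl rfl) (htL.imp_right Or.inr)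
      rw [List.nodup_cons] at hnd
      have := ih h1 (Or.inl rfl) hq hch.2 hnd.2 ?_ (fun y hy hyx => hy.resolve_left hyx) ?_
        (Or.inl ⟨x, Or.inl rfl, t, Or.inr ht, ?_⟩)
      · convert this using 1
        ext y
        simp only [mem_union, mem_ofPred_eq, List.mem_cons, Set.mem_insert_iff]
        tauto
      · rintro y hy (rfl | hyS)
        · exact hnd.1 hy
        · exact hdis y (by simp [hy]) hyS
      · intro b hb
        refine hlast b ?_
        rw [List.getLast?_cons, hb]
        rfl
      · rintro rfl
        exact hdis x (by simp) ht

theorem hasTree_list {l : List V} {a b : V} (hch : l.IsChain G.Adj) (hnd : l.Nodup)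
    (ha : l.head? = some a) (hb : l.getLast? = some b) : HasTree G {x | x ∈ l} {a, b} := by
  obtain ⟨q, rfl⟩ : ∃ q, l = a :: q := ⟨l.tail, List.eq_cons_of_mem_head? ha⟩
  by_cases hq : q = []
  · subst hq
    convert hasTree_singleton G a _ using 1
    ext; simp
  · rw [List.nodup_cons] at hnd
    have := (hasTree_singleton G a {a, b}).extend (L' := {a, b}) rfl hq hch hnd.2 ?_
      (fun x hx _ => hx) ?_ (Or.inr (by simp))
    · convert this using 1
      ext; simp
    · rintro x hx rfl
      exact hnd.1 hx
    · intro c hc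
      rw [List.getLast?_cons, hc] at hb
      simp at hb
      simp [hb]

theorem HasTree.hang {S L L' : Set V} (h : HasTree G S L) (hS : S.Nontrivial) {l : List V}
    {a b t z : V} (hch : l.IsChain G.Adj) (hnd : l.Nodup) (ha : l.head? = some a)
    (hb : l.getLast? = some b) (ht : t ∈ S) (hz : z ∈ l) (hadj : G.Adj t z)
    (hdis : ∀ x ∈ l, x ∉ S) (hL : L ⊆ L') (haL : a ∈ L') (hbL : b ∈ L') :
    HasTree G (S ∪ {x | x ∈ l}) L' := by
  obtain ⟨p, q, rfl⟩ := List.append_of_mem hz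
  rw [List.append_cons] at hch hnd ha
  have hch' := List.isChain_append.1 hch
  have hnd' := List.nodup_append.1 hnd
  have h1 := h.extend (q := (p ++ [z]).reverse) (L' := L') ht (by simp) ?_
    (List.nodup_reverse.2 hnd'.1) ?_
    (fun x hx _ => hL hx) ?_ (Or.inl hS)
  · by_cases hq : q = []
    · subst hq
      convert h1 using 2
      ext; simp [or_comm]
    · have := h1.extend (L' := L') (t := z) (Or.inr (by simp)) hq ?_ hnd'.2.1 ?_
        (fun x hx _ => hx) ?_ (Or.inl (hS.mono subset_union_left))
      · convert this using 1
        ext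
        simp only [mem_union, mem_ofPred_eq, List.mem_append, List.mem_cons, List.mem_reverse]
        tauto
      · refine List.isChain_cons.2 ⟨fun y hy => hch'.2.2 z (by simp) y hy, hch'.2.1⟩
      · rintro x hx (hxS | hxp)
        · exact hdis x (by simp [hx]) hxS
        · exact hnd'.2.2 x (List.mem_reverse.1 hxp) x hx rfl
      · intro c hc
        rw [List.getLast?_append, List.getLast?_cons, hc] at hb
        simp at hb
        exact hb ▸ hbL
  · refine List.isChain_cons.2 ⟨fun y hy => ?_, ?_⟩
    · simp at hy
      exact hy ▸ hadj
    · exact List.isChain_reverse.2 (hch'.1.imp fun _ _ h => h.symm)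
  · intro x hx
    refine hdis x ?_
    simp at hx ⊢
    tauto
  · intro c hc
    rw [List.getLast?_reverse] at hc
    rw [List.head?_append, hc] at ha
    simp at ha
    exact ha ▸ haL

theorem HasTree.hang_closed {S L L' : Set V} (h : HasTree G S L) (hS : S.Nontrivial) {l : List V}
    [DecidableEq V]
    {t z : V} (hch : l.IsChain G.Adj) (hnd : l.Nodup) (hc : ClosedList G l)
    (ht : t ∈ S) (hz : z ∈ l) (hadj : G.Adj t z)
    (hdis : ∀ x ∈ l, x ∉ S) (hL : L ⊆ L') (hlL : l.next z hz ∈ L') :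
    HasTree G (S ∪ {x | x ∈ l}) L' := by
  obtain ⟨q, h1, h2, h3, h4⟩ := (exists_seg_of_closed hnd hch hc hz).symm
  have hmem : ∀ x, x ∈ q ↔ x ∈ l := fun x => by
    rw [← Multiset.mem_coe, h4, Multiset.mem_coe]
  have := h.extend (q := q) (L' := L') ht (by rintro rfl; simp at h1) ?_ ?_
    (fun x hx => hdis x ((hmem x).1 hx)) (fun x hx _ => hL hx) ?_ (Or.inl hS)
  · simpa only [hmem] using this
  · refine List.isChain_cons.2 ⟨fun y hy => ?_, h3⟩
    rw [h1] at hy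
    cases hy
    exact hadj
  · rw [← Multiset.coe_nodup, h4, Multiset.coe_nodup]; exact hnd
  · intro b hb
    rw [h2] at hb
    cases hb
    exact hlL

theorem ncard_pair_le (a b : V) : ({a, b} : Set V).ncard ≤ 2 := by
  simpa using Set.ncard_insert_le a {b}

theorem HasTree.exists_subgraph [Finite V] {L : Set V} [Nonempty V] (h : HasTree G Set.univ L) :
    ∃ T : G.Subgraph, T.IsSpanning ∧ T.coe.IsTree ∧ (subLeaves T).ncard ≤ L.ncard := by
  obtain ⟨T, hle, hac, hr, -, hl⟩ := h
  have hs : (toSubgraph T hle).IsSpanning := toSubgraph.isSpanning T hle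
  refine ⟨toSubgraph T hle, hs, ?_, Set.ncard_le_ncard fun v hv => hl v hv.2⟩
  rw [← ((toSubgraph T hle).spanningCoeEquivCoeOfSpanning hs).isTree_iff]
  exact ⟨⟨fun u v => hr u trivial v trivial⟩, hac⟩

theorem IsMaximalSys.exists_hasTree [DecidableEq V] {F : Finset (List V)} (hF : IsMaximalSys G F)
    (hG : G.Connected) (hcov : ∀ v, v ∈ coverOf F) :
    ∃ L : Set V, HasTree G Set.univ L ∧ L.ncard ≤ max 2 (weightOf G F) := by
  by_cases hop : ∃ l ∈ F, ¬ ClosedList G l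
  · obtain ⟨l, hl, ho⟩ := hop
    obtain ⟨a, b, ha, hb⟩ := exists_ends (hF.ne_nil l hl)
    have hab := (ends_of_not_closed ho ha hb).1
    classical
    let good : Finset (List V) → Prop := fun E => l ∈ E ∧
      ∃ L : Set V, HasTree G {v | v ∈ coverOf E} L ∧ L.ncard ≤ weightOf G E
    have hgood : (F.powerset.filter good).Nonempty := by
      refine ⟨{l}, Finset.mem_filter.2 ⟨by simpa using hl, by simp, {a, b}, ?_, ?_⟩⟩
      · simpa [coverOf_singleton] using hasTree_list (hF.chain l hl) (hF.list_nodup hl) ha hb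
      · rw [weightOf_singleton, wt_of_not_closed ho]
        exact ncard_pair_le a b
    obtain ⟨E, hE, hmax⟩ := Finset.exists_max_image _ Finset.card hgood
    simp only [Finset.mem_filter, Finset.mem_powerset] at hE hmax
    obtain ⟨hEF, hlE, L, hT, hL⟩ := hE
    suffices hs : E = F by
      subst hs
      refine ⟨L, ?_, hL.trans (le_max_right _ _)⟩
      convert hT
      exact (Set.eq_univ_of_forall hcov).symm
    by_contra hne
    obtain ⟨m, hmF, hmE⟩ := Finset.exists_of_ssubset (hEF.ssubset_of_ne hne)
    have hout : ∃ t ∈ coverOf E, ∃ z, z ∉ coverOf E ∧ G.Adj t z := by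
      by_contra! hcl
      obtain ⟨x, hx⟩ := List.exists_mem_of_ne_nil m (hF.ne_nil m hmF)
      have hxE : x ∈ coverOf E := mem_of_reachable (H := {v | v ∈ coverOf E})
        (fun u hu v hv => by_contra fun h => hcl u hu v h hv) (hG.preconnected a x)
        (mem_coverOf.2 ⟨l, hlE, List.mem_of_mem_head? ha⟩)
      obtain ⟨m', hm', hxm'⟩ := mem_coverOf.1 hxE
      exact hmE (hF.eq_of_mem hmF (hEF hm') hx hxm' ▸ hm')
    obtain ⟨t, ht, z, hz, hadj⟩ := hout
    obtain ⟨n, hnF, hzn⟩ := mem_coverOf.1 (hcov z)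
    have hnE : n ∉ E := fun h => hz (mem_coverOf.2 ⟨n, h, hzn⟩)
    have hdis : ∀ x ∈ n, x ∉ {v | v ∈ coverOf E} := by
      intro x hx hxE
      obtain ⟨m', hm', hxm'⟩ := mem_coverOf.1 hxE
      exact hnE (hF.eq_of_mem hnF (hEF hm') hx hxm' ▸ hm')
    have hnt : {v | v ∈ coverOf E}.Nontrivial :=
      ⟨a, mem_coverOf.2 ⟨l, hlE, List.mem_of_mem_head? ha⟩, b,
        mem_coverOf.2 ⟨l, hlE, List.mem_of_getLast? hb⟩, hab⟩
    have hset : {v | v ∈ coverOf (insert n E)} = {v | v ∈ coverOf E} ∪ {x | x ∈ n} := by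
      ext; simp [mem_coverOf, or_comm]
    have hwt : weightOf G (insert n E) = wt G n + weightOf G E := Finset.sum_insert hnE
    have hnot : ¬ good (insert n E) := fun h => by
      have := hmax (insert n E) ⟨Finset.insert_subset hnF hEF, h⟩
      rw [Finset.card_insert_of_notMem hnE] at this
      omega
    obtain ⟨c, d, hc, hd⟩ := exists_ends (hF.ne_nil n hnF)
    apply hnot
    refine ⟨Finset.mem_insert_of_mem hlE, ?_⟩
    rw [hset, hwt]
    by_cases hcl : ClosedList G n
    · refine ⟨insert (n.next z hzn) L, hT.hang_closed hnt (hF.chain n hnF) (hF.list_nodup hnF) hcl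
        ht hzn hadj hdis (subset_insert _ _) (mem_insert _ _), ?_⟩
      have := Set.ncard_insert_le (n.next z hzn) L
      rw [wt_of_closed hcl]
      omega
    · refine ⟨insert c (insert d L), hT.hang hnt (hF.chain n hnF) (hF.list_nodup hnF) hc hd ht hzn
        hadj hdis ((subset_insert _ _).trans (subset_insert _ _)) (by simp) (by simp), ?_⟩
      have := Set.ncard_insert_le c (insert d L)
      have := Set.ncard_insert_le d L
      rw [wt_of_not_closed hcl]
      omega
  · push Not at hop
    obtain ⟨v⟩ := hG.nonempty
    obtain ⟨l, hl, hv⟩ := mem_coverOf.1 (hcov v)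
    obtain ⟨a, b, ha, hb⟩ := exists_ends (hF.ne_nil l hl)
    refine ⟨{a, b}, ?_, (ncard_pair_le a b).trans (le_max_left _ _)⟩
    convert hasTree_list (hF.chain l hl) (hF.list_nodup hl) ha hb
    refine (Set.eq_univ_of_forall fun x => ?_).symm
    refine mem_of_reachable (fun u hu w hw => ?_) (hG.preconnected v x) hv
    obtain ⟨m, hm, hwm⟩ := mem_coverOf.1 (hcov w)
    by_contra hwl
    refine hF.closed_not_adj l hl m hm ?_ (hop l hl) (hop m hm) u hu w hwm hw
    rintro rfl
    exact hwl hwm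

end Trees

/-- Win's theorem: if `G` is connected and `α(G) ≤ k + κ(G) - 1` (`k ≥ 2`), then `G`
has a spanning tree with at most `k` leaves. -/
theorem stmt_5 [Fintype V] (G : SimpleGraph V) (hG : G.Connected)
    (k : ℕ) (hk : 2 ≤ k)
    (hακ : indepNumOn G Set.univ + 1 ≤ k + vertexConn G) :
    ∃ T : G.Subgraph, T.IsSpanning ∧ T.coe.IsTree ∧ (subLeaves T).ncard ≤ k := by
  classical
  have := hG.nonempty
  obtain ⟨F, hF, hw, hcov⟩ := exists_spanning_sys (by omega) hακ
  obtain ⟨L, hT, hL⟩ := hF.exists_hasTree hG hcov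
  obtain ⟨T, h1, h2, h3⟩ := hT.exists_subgraph
  exact ⟨T, h1, h2, h3.trans (hL.trans (max_le hk hw))⟩
end

section
/- Let G be a 2-connected finite simple graph and S ⊆ V(G). If α_G(S) ≤ κ(G), then G has a cycle C with S ⊆ V(C). -/
open SimpleGraph Set

variable {V : Type*}

namespace SimpleGraph

theorem exists_isPath_of_injOn (G : SimpleGraph V) (f : ℕ → V) {a b : ℕ} (hab : a ≤ b)
    (hadj : ∀ k, a ≤ k → k < b → G.Adj (f k) (f (k + 1))) (hinj : InjOn f (Icc a b)) :
    ∃ p : G.Walk (f a) (f b), p.IsPath ∧ ∀ y, y ∈ p.support ↔ ∃ k, a ≤ k ∧ k ≤ b ∧ f k = y := by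
  induction b, hab using Nat.le_induction with
  | base =>
    refine ⟨Walk.nil, Walk.IsPath.nil, fun y => ?_⟩
    simp only [Walk.support_nil, List.mem_singleton]
    exact ⟨fun h => ⟨a, le_rfl, le_rfl, h.symm⟩,
      fun ⟨k, h1, h2, h3⟩ => by rw [← h3, le_antisymm h2 h1]⟩
  | succ b hab ih =>
    obtain ⟨p, hp, hs⟩ := ih (fun k h1 h2 => hadj k h1 (by omega))
      (hinj.mono (Icc_subset_Icc_right (Nat.le_succ b)))
    refine ⟨p.concat (hadj b hab (Nat.lt_succ_self b)), ?_, fun y => ?_⟩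
    · refine hp.concat (fun hmem => ?_) _
      obtain ⟨k, h1, h2, h3⟩ := (hs _).1 hmem
      have := hinj ⟨h1, by omega⟩ ⟨by omega, le_rfl⟩ h3
      omega
    · rw [Walk.support_concat, List.mem_append, hs, List.mem_singleton]
      constructor
      · rintro (⟨k, h1, h2, h3⟩ | h)
        · exact ⟨k, h1, by omega, h3⟩
        · exact ⟨b + 1, by omega, le_rfl, h.symm⟩
      · rintro ⟨k, h1, h2, h3⟩
        rcases Nat.lt_or_ge b k with h | h
        · right
          rw [← h3, show k = b + 1 by omega]
        · exact Or.inl ⟨k, h1, h, h3⟩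

/-- The relation whose matchings encode systems of disjoint paths leaving `x` and ending in `A`. -/
def fanRel (G : SimpleGraph V) (x : V) (A : Finset V) (t : ℕ) : Fin t ⊕ V → Fin t ⊕ V → Prop
  | .inl _, .inl _ => False
  | .inl _, .inr w => G.Adj x w
  | .inr v, .inl _ => v ∈ A
  | .inr v, .inr w => v = w ∨ (v ≠ x ∧ G.Adj v w)

theorem Reachable.mem_of_forall_adj {G : SimpleGraph V} {u w : V} (h : G.Reachable u w)
    {U : Set V} (hu : u ∈ U) (hU : ∀ a b, a ∈ U → G.Adj a b → b ∈ U) : w ∈ U := by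
  obtain ⟨p⟩ := h
  induction p with
  | nil => exact hu
  | cons hadj _ ih => exact ih (hU _ _ hu hadj)

theorem exists_injective_fanRel [Fintype V] (G : SimpleGraph V) {x : V} {A : Finset V} (hx : x ∉ A)
    {t : ℕ} (ht : t ≤ A.card)
    (hconn : ∀ X : Finset V, X.card < t → (G.induce ((↑X : Set V)ᶜ)).Connected) :
    ∃ f : Fin t ⊕ V → Fin t ⊕ V, Function.Injective f ∧ ∀ z, fanRel G x A t z (f z) := by
  classical
  rw [← Fintype.all_card_le_filter_rel_iff_exists_injective]
  intro B
  set N : Finset (Fin t ⊕ V) := Finset.univ.filter fun b => ∃ a ∈ B, fanRel G x A t a b with hN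
  have memN : ∀ b, b ∈ N ↔ ∃ a ∈ B, fanRel G x A t a b := by simp [hN]
  rw [← Finset.card_toLeft_add_card_toRight (u := B),
    ← Finset.card_toLeft_add_card_toRight (u := N)]
  have hsub : B.toRight ⊆ N.toRight := by
    intro v hv
    rw [Finset.mem_toRight] at hv ⊢
    exact (memN _).2 ⟨_, hv, Or.inl rfl⟩
  have hle := Finset.card_le_card hsub
  have hlt : B.toLeft.card ≤ t := by simpa using Finset.card_le_univ B.toLeft
  rcases B.toLeft.eq_empty_or_nonempty with h0 | ⟨i, hi⟩
  · rw [h0, Finset.card_empty]; omega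
  rw [Finset.mem_toLeft] at hi
  by_cases hA : ∃ a ∈ A, a ∈ B.toRight
  · obtain ⟨a, haA, ha⟩ := hA
    rw [Finset.mem_toRight] at ha
    have : N.toLeft = Finset.univ := by
      ext j
      simp only [Finset.mem_toLeft, Finset.mem_univ, iff_true]
      exact (memN _).2 ⟨_, ha, haA⟩
    rw [this, Finset.card_univ, Fintype.card_fin]
    omega
  push Not at hA
  by_contra! hcon
  set Z := (N.toRight \ B.toRight).erase x with hZ
  have hZle : Z.card ≤ (N.toRight \ B.toRight).card := Finset.card_erase_le
  have hd := Finset.card_sdiff_add_card_eq_card hsub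
  have hZt : Z.card < t := by omega
  obtain ⟨a, haA, haZ⟩ := Finset.exists_mem_notMem_of_card_lt_card (hZt.trans_le ht)
  have hxZ : x ∉ Z := by simp [hZ]
  have hreach := (hconn Z hZt).preconnected ⟨x, by simpa using hxZ⟩ ⟨a, by simpa using haZ⟩
  have := hreach.mem_of_forall_adj (U := {z | z.1 = x ∨ z.1 ∈ B.toRight}) (Or.inl rfl) (by
    rintro ⟨u, hu⟩ ⟨w, hw⟩ huU hadj
    have hadj' : G.Adj u w := hadj
    have hwN : w ∈ N.toRight := by
      rw [Finset.mem_toRight, memN]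
      by_cases hux : u = x
      · exact ⟨_, hi, by subst hux; exact hadj'⟩
      · refine ⟨_, Finset.mem_toRight.1 (huU.resolve_left hux), Or.inr ⟨hux, hadj'⟩⟩
    have hw' : w ∉ Z := by simpa using hw
    simp only [hZ, Finset.mem_erase, Finset.mem_sdiff, not_and, not_not] at hw'
    by_cases hwx : w = x
    · exact Or.inl hwx
    · exact Or.inr (hw' hwx hwN))
  rcases this with h | h
  · exact hx (by simpa using h ▸ haA)
  · exact hA a haA h

/-- The fan lemma. -/
theorem exists_fan [Fintype V] (G : SimpleGraph V) {x : V} {A : Finset V} (hx : x ∉ A)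
    {t : ℕ} (ht : t ≤ A.card)
    (hconn : ∀ X : Finset V, X.card < t → (G.induce ((↑X : Set V)ᶜ)).Connected) :
    ∃ (v : Fin t → V) (p : ∀ i, G.Walk x (v i)), (∀ i, (p i).IsPath) ∧
      (∀ i, ∀ y ∈ (p i).support, y ∈ A ↔ y = v i) ∧
      ∀ i j, i ≠ j → ∀ y ∈ (p i).support, y ∈ (p j).support → y = x := by
  classical
  obtain ⟨f, hf, hrel⟩ := exists_injective_fanRel G hx ht hconn
  have hnofix : ∀ i l, f (f^[l] (.inl i)) ≠ f^[l] (.inl i) := by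
    intro i l h
    rw [← Function.iterate_succ_apply' f, Function.iterate_succ_apply] at h
    have := hrel (.inl i)
    rw [hf.iterate l h] at this
    exact this
  have hfx : f (.inr x) = .inr x := by
    have := hrel (.inr x)
    rcases hz : f (.inr x) with j | w
    · rw [hz] at this; exact (hx this).elim
    · rw [hz] at this
      rcases this with h | h
      · rw [h]
      · exact (h.1 rfl).elim
  set P : Fin t ⊕ V → Prop := Sum.elim (fun _ => True) (· ∈ A)
  have hex : ∀ i : Fin t, ∃ l, 1 ≤ l ∧ P (f^[l] (.inl i)) := by
    intro i
    obtain ⟨n, hn, h⟩ := hf.mem_periodicPts (.inl i)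
    exact ⟨n, hn, by rw [h.eq]; trivial⟩
  choose m hm hmin using fun i => (⟨Nat.find (hex i), Nat.find_spec (hex i),
    fun _ => Nat.find_min (hex i)⟩ :
    ∃ m, (1 ≤ m ∧ P (f^[m] (.inl i))) ∧ ∀ l < m, ¬ (1 ≤ l ∧ P (f^[l] (.inl i))))
  set g : Fin t → ℕ → V := fun i l => Sum.elim (fun _ => x) id (f^[l] (.inl i)) with hg
  have hg0 : ∀ i, g i 0 = x := fun i => rfl
  have hlow : ∀ i l, 1 ≤ l → l < m i → f^[l] (.inl i) = .inr (g i l) ∧ g i l ∉ A := by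
    intro i l h1 h2
    have := hmin i l h2
    rcases hz : f^[l] (.inl i) with j | w
    · exact (this ⟨h1, by rw [hz]; trivial⟩).elim
    · simp only [hg, hz, Sum.elim_inr, id]
      exact ⟨trivial, fun hw => this ⟨h1, by rw [hz]; exact hw⟩⟩
  have htop : ∀ i, f^[m i] (.inl i) = .inr (g i (m i)) ∧ g i (m i) ∈ A := by
    intro i
    obtain ⟨h1, h2⟩ := hm i
    rcases hz : f^[m i] (.inl i) with j | w
    · exfalso
      obtain ⟨k, hk⟩ : ∃ k, m i = k + 1 := ⟨m i - 1, by omega⟩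
      rw [hk, Function.iterate_succ_apply'] at hz
      have hr := hrel (f^[k] (.inl i))
      rw [hz] at hr
      rcases Nat.eq_zero_or_pos k with h0 | hpos
      · rw [h0] at hr; exact hr
      · obtain ⟨h3, h4⟩ := hlow i k hpos (by omega)
        rw [h3] at hr
        exact h4 hr
    · rw [hz] at h2
      simp only [hg, hz, Sum.elim_inr, id]
      exact ⟨trivial, h2⟩
  have hinr : ∀ i l, 1 ≤ l → l ≤ m i → f^[l] (.inl i) = .inr (g i l) := by
    intro i l h1 h2
    rcases h2.lt_or_eq with h | h
    · exact (hlow i l h1 h).1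
    · rw [h]; exact (htop i).1
  have hgx : ∀ i l, 1 ≤ l → l ≤ m i → g i l ≠ x := by
    intro i l h1 h2 h
    have h3 := hinr i l h1 h2
    apply hnofix i l
    rw [h3, h, hfx]
  have hkey : ∀ i j a b, a ≤ b → b ≤ m j → f^[a] (.inl i) = f^[b] (.inl j) → a = b ∧ i = j := by
    intro i j a b hab hb h
    obtain ⟨c, rfl⟩ := Nat.exists_eq_add_of_le hab
    rw [Function.iterate_add_apply] at h
    have h' := hf.iterate a h
    rcases Nat.eq_zero_or_pos c with rfl | hc
    · simpa using h'
    · rw [hinr j c hc (by omega)] at h'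
      cases h'
  have hgkey : ∀ i j a b, 1 ≤ a → a ≤ m i → 1 ≤ b → b ≤ m j → g i a = g j b → a = b ∧ i = j := by
    intro i j a b ha ha' hb hb' h
    have h' : f^[a] (.inl i) = f^[b] (.inl j) := by rw [hinr i a ha ha', hinr j b hb hb', h]
    rcases le_total a b with hab | hab
    · exact hkey i j a b hab hb' h'
    · exact (hkey j i b a hab ha' h'.symm).imp Eq.symm Eq.symm
  have hpath : ∀ i, ∃ p : G.Walk (g i 0) (g i (m i)), p.IsPath ∧
      ∀ y, y ∈ p.support ↔ ∃ k, 0 ≤ k ∧ k ≤ m i ∧ g i k = y := by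
    intro i
    refine exists_isPath_of_injOn G (g i) (Nat.zero_le _) (fun k _ hk => ?_) ?_
    · have hr := hrel (f^[k] (.inl i))
      rw [← Function.iterate_succ_apply' f, hinr i (k + 1) (by omega) hk] at hr
      rcases Nat.eq_zero_or_pos k with rfl | hpos
      · exact hr
      · have h3 := hinr i k hpos hk.le
        rw [h3] at hr
        rcases hr with h | h
        · have := (hgkey i i k (k + 1) hpos hk.le (by omega) hk h).1
          omega
        · exact h.2
    · rintro a ⟨-, ha⟩ b ⟨-, hb⟩ h
      rcases Nat.eq_zero_or_pos a with rfl | ha0 <;> rcases Nat.eq_zero_or_pos b with rfl | hb0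
      · rfl
      · exact (hgx i b hb0 hb h.symm).elim
      · exact (hgx i a ha0 ha h).elim
      · exact (hgkey i i a b ha0 ha hb0 hb h).1
  choose p hp hs using hpath
  refine ⟨fun i => g i (m i), p, hp, fun i y hy => ?_, fun i j hij y hyi hyj => ?_⟩
  · obtain ⟨k, -, hk, rfl⟩ := (hs i y).1 hy
    refine ⟨fun hA => ?_, fun h => h ▸ (htop i).2⟩
    rcases hk.lt_or_eq with hlt | rfl
    · rcases Nat.eq_zero_or_pos k with rfl | hpos
      · exact (hx hA).elim
      · exact ((hlow i k hpos hlt).2 hA).elim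
    · rfl
  · obtain ⟨k, -, hk, rfl⟩ := (hs i y).1 hyi
    obtain ⟨l, -, hl, h⟩ := (hs j _).1 hyj
    rcases Nat.eq_zero_or_pos k with rfl | hk0
    · rfl
    rcases Nat.eq_zero_or_pos l with rfl | hl0
    · exact h.symm
    exact (hij (hgkey i j k l hk0 hk hl0 hl h.symm).2).elim

end SimpleGraph

namespace SimpleGraph

theorem Walk.IsPath.append_of_inter {G : SimpleGraph V} {u v w : V} {p : G.Walk u v}
    {q : G.Walk v w} (hp : p.IsPath) (hq : q.IsPath)
    (h : ∀ y ∈ p.support, y ∈ q.support → y = v) : (p.append q).IsPath := by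
  rw [Walk.isPath_def, Walk.support_append, List.nodup_append']
  have hq' := hq.support_nodup
  rw [← Walk.cons_tail_support, List.nodup_cons] at hq'
  refine ⟨hp.support_nodup, hq'.2, fun y hy hy' => ?_⟩
  rw [h y hy (List.mem_of_mem_tail hy')] at hy'
  exact hq'.1 hy'

theorem Walk.IsPath.isCycle_cons_of_two_le_length {G : SimpleGraph V} {u v : V} {p : G.Walk u v}
    (hp : p.IsPath) (hlen : 2 ≤ p.length) (h : G.Adj v u) : (Walk.cons h p).IsCycle := by
  rw [Walk.cons_isCycle_iff]
  refine ⟨hp, fun hmem => ?_⟩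
  cases p with
  | nil => simp at hlen
  | cons h' q =>
    rw [Walk.cons_isPath_iff] at hp
    rw [Walk.edges_cons, List.mem_cons] at hmem
    rcases hmem with hmem | hmem
    · rw [Sym2.eq_iff] at hmem
      rcases hmem with ⟨h1, -⟩ | ⟨h1, -⟩
      · exact h.ne h1
      · subst h1
        have := (Walk.isPath_iff_nil.1 hp.1).length_eq_zero
        rw [Walk.length_cons] at hlen
        omega
    · exact hp.2 (Walk.snd_mem_support_of_mem_edges q hmem)

/-- Three paths forming a triangle close up to a cycle. -/
theorem exists_isCycle_of_isPath_triangle {G : SimpleGraph V} {x u w : V} {p : G.Walk x u}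
    {p' : G.Walk x w} {q : G.Walk u w} (hp : p.IsPath) (hp' : p'.IsPath) (hq : q.IsPath)
    (huw : u ≠ w) (hx : x ∉ q.support) (hpq : ∀ y ∈ p.support, y ∈ q.support → y = u)
    (hpq' : ∀ y ∈ p'.support, y ∈ q.support → y = w)
    (hpp' : ∀ y ∈ p.support, y ∈ p'.support → y = x) :
    ∃ (z : V) (c : G.Walk z z), c.IsCycle ∧ x ∈ c.support ∧ ∀ y ∈ q.support, y ∈ c.support := by
  cases p' with
  | nil => exact (hx q.end_mem_support).elim
  | @cons _ z _ h r =>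
    rw [Walk.cons_isPath_iff] at hp'
    have h1 : (p.append q).IsPath := hp.append_of_inter hq hpq
    have h2 : ((p.append q).append r.reverse).IsPath := by
      refine h1.append_of_inter hp'.1.reverse fun y hy hyr => ?_
      rw [Walk.support_reverse, List.mem_reverse] at hyr
      have hyr' : y ∈ (Walk.cons h r).support := List.mem_cons_of_mem _ hyr
      rcases (Walk.mem_support_append_iff _ _).1 hy with hy | hy
      · exact (hp'.2 (hpp' y hy hyr' ▸ hyr)).elim
      · exact hpq' y hyr' hy
    refine ⟨z, _, h2.isCycle_cons_of_two_le_length ?_ h.symm, ?_, fun y hy => ?_⟩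
    · have h3 : p.length ≠ 0 := fun h0 => by
        obtain rfl := Walk.eq_of_length_eq_zero h0
        exact hx q.start_mem_support
      have h4 : q.length ≠ 0 := fun h0 => huw (Walk.eq_of_length_eq_zero h0)
      simp only [Walk.length_append]
      omega
    · simp
    · simp [Walk.mem_support_append_iff, hy]

theorem exists_ge_lt_modEq {n : ℕ} (hn : 0 < n) (a k : ℕ) :
    ∃ k', a < k' ∧ k' ≤ a + n ∧ k' ≡ k [MOD n] := by
  refine ⟨a + n - (a + n - k % n) % n, ?_, Nat.sub_le _ _, ?_⟩
  · have := Nat.mod_lt (a + n - k % n) hn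
    omega
  · have h1 := Nat.mod_lt k hn
    have h2 := Nat.mod_add_div (a + n - k % n) n
    have h3 : a + n - (a + n - k % n) % n = k % n + n * ((a + n - k % n) / n) := by omega
    rw [h3]
    simp [Nat.ModEq]

theorem modEq_injOn {n a b c : ℕ} (hb : a < b ∧ b ≤ a + n) (hc : a < c ∧ c ≤ a + n)
    (h : b ≡ c [MOD n]) : b = c := by
  wlog hbc : b ≤ c generalizing b c
  · exact (this hc hb h.symm (by omega)).symm
  obtain ⟨e, rfl⟩ := Nat.exists_eq_add_of_le hbc
  have h1 : n ∣ e := by simpa using (Nat.modEq_iff_dvd' hbc).1 h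
  rcases Nat.eq_zero_or_pos e with rfl | he
  · rfl
  · have := Nat.le_of_dvd he h1
    omega

theorem exists_isPath_of_modEq {G : SimpleGraph V} {n : ℕ} {f : ℕ → V}
    (hadj : ∀ k, G.Adj (f k) (f (k + 1))) (hinj : ∀ a b, f a = f b ↔ a ≡ b [MOD n])
    {a b : ℕ} (hab : a ≤ b) (hbn : b < a + n) :
    ∃ p : G.Walk (f a) (f b), p.IsPath ∧ ∀ y, y ∈ p.support ↔ ∃ k, a ≤ k ∧ k ≤ b ∧ f k = y := by
  refine exists_isPath_of_injOn G f hab (fun k _ _ => hadj k) ?_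
  rintro k ⟨hk1, hk2⟩ l ⟨hl1, hl2⟩ h
  have h1 := Nat.ModEq.add_right 1 ((hinj _ _).1 h)
  have := modEq_injOn (a := a) (by omega) (by omega) h1
  omega

/-- Let `f` run around a cycle, let `x` lie off the cycle with a fan to it, and suppose no
rerouting of the cycle through `x` keeps all vertices of `S`. Then the first vertices of `S` after
the ends of the fan form, together with `x`, an independent set. -/
theorem exists_indep_of_fan {G : SimpleGraph V} {n : ℕ} (hn : 0 < n) {f : ℕ → V}
    (hadj : ∀ k, G.Adj (f k) (f (k + 1))) (hinj : ∀ a b, f a = f b ↔ a ≡ b [MOD n])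
    {S : Set V} {x : V} (hx : x ∉ range f)
    (hmax : ∀ u w (p : G.Walk x u) (p' : G.Walk x w) (q : G.Walk u w), p.IsPath → p'.IsPath →
      q.IsPath → u ≠ w → (∀ y ∈ p.support, y ∈ range f → y = u) →
      (∀ y ∈ p'.support, y ∈ range f → y = w) → (∀ y ∈ p.support, y ∈ p'.support → y = x) →
      (∀ y ∈ q.support, y ∈ range f) → ∃ y ∈ S, y ∈ range f ∧ y ∉ q.support)
    {t : ℕ} (ht : 2 ≤ t) {v : Fin t → V} (hv : Function.Injective v)
    (p : ∀ i, G.Walk x (v i)) (hp : ∀ i, (p i).IsPath)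
    (hpf : ∀ i, ∀ y ∈ (p i).support, y ∈ range f ↔ y = v i)
    (hpp : ∀ i j, i ≠ j → ∀ y ∈ (p i).support, y ∈ (p j).support → y = x) :
    ∃ s : Fin t → V, Function.Injective s ∧ (∀ i, s i ∈ S ∧ s i ∈ range f ∧ s i ∉ range v ∧
      ¬ G.Adj x (s i)) ∧ ∀ i j, i ≠ j → ¬ G.Adj (s i) (s j) := by
  classical
  have hvf : ∀ i, v i ∈ range f := fun i => (hpf i _ (p i).end_mem_support).2 rfl
  have hrep : ∀ a k, ∃ k', a < k' ∧ k' ≤ a + n ∧ f k' = f k := by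
    intro a k
    obtain ⟨k', h1, h2, h3⟩ := exists_ge_lt_modEq hn a k
    exact ⟨k', h1, h2, (hinj _ _).2 h3⟩
  have hper : ∀ a, f (a + n) = f a := fun a => (hinj _ _).2 (by simp [Nat.ModEq])
  choose a ha using hvf
  have hex : ∀ i, ∃ d, 1 ≤ d ∧ (f (a i + d) ∈ S ∨ f (a i + d) ∈ range v) :=
    fun i => ⟨n, hn, Or.inr ⟨i, by rw [hper, ha]⟩⟩
  choose d hd hmin using fun i => (⟨Nat.find (hex i), Nat.find_spec (hex i),
    fun _ => Nat.find_min (hex i)⟩ :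
    ∃ d, (1 ≤ d ∧ (f (a i + d) ∈ S ∨ f (a i + d) ∈ range v)) ∧
      ∀ e < d, ¬ (1 ≤ e ∧ (f (a i + e) ∈ S ∨ f (a i + e) ∈ range v)))
  have hdle : ∀ i e, 1 ≤ e → f (a i + e) ∈ S ∨ f (a i + e) ∈ range v → d i ≤ e :=
    fun i e h1 h2 => not_lt.1 fun h => hmin i e h ⟨h1, h2⟩
  have hother : ∀ i j, i ≠ j → ∃ b, a i < b ∧ b < a i + n ∧ f b = v j := by
    intro i j hij
    obtain ⟨b, h1, h2, h3⟩ := hrep (a i) (a j)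
    rw [ha] at h3
    refine ⟨b, h1, lt_of_le_of_ne h2 ?_, h3⟩
    rintro rfl
    rw [hper, ha] at h3
    exact hv.ne hij h3
  have hdn : ∀ i, d i < n := by
    intro i
    have : ∃ j : Fin t, i ≠ j := by
      have : Nontrivial (Fin t) := Fin.nontrivial_iff_two_le.2 ht
      obtain ⟨j, hj⟩ := exists_ne i
      exact ⟨j, hj.symm⟩
    obtain ⟨j, hij⟩ := this
    obtain ⟨b, h1, h2, h3⟩ := hother i j hij
    have := hdle i (b - a i) (by omega)
      (Or.inr ⟨j, by rw [show a i + (b - a i) = b by omega, h3]⟩)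
    omega
  have hne : ∀ i, f (a i + d i) ≠ v i := by
    intro i h
    rw [← ha i, ← hper (a i), hinj] at h
    have := modEq_injOn (a := a i) ⟨by have := (hd i).1; omega, by have := hdn i; omega⟩
      (by omega) h
    have := hdn i
    omega
  have hnopath : ∀ i (p' : G.Walk x (f (a i + d i))), p'.IsPath →
      (∀ y ∈ p'.support, y ∈ range f → y = f (a i + d i)) →
      (∀ y ∈ p'.support, y ∈ (p i).support → y = x) → False := by
    intro i p' hp' h1 h2
    obtain ⟨q, hq, hqs⟩ := exists_isPath_of_modEq hadj hinj (a := a i + d i) (b := a i + n)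
      (by have := hdn i; omega) (by have := (hd i).1; omega)
    obtain ⟨y, hyS, ⟨k, rfl⟩, hyq⟩ := hmax _ _ p' ((p i).copy rfl (by rw [hper, ha])) q hp'
      (by simpa using hp i) hq (by rw [hper, ha]; exact hne i) h1
      (fun y hy hyf => by
        rw [hper, ha]
        exact (hpf i y (by simpa using hy)).1 hyf)
      (fun y hy hy' => h2 y hy (by simpa using hy'))
      (fun y hy => by
        obtain ⟨k, -, -, rfl⟩ := (hqs y).1 hy
        exact ⟨k, rfl⟩)
    obtain ⟨k', h3, h4, h5⟩ := hrep (a i) k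
    have := hdle i (k' - a i) (by omega)
      (Or.inl (by rw [show a i + (k' - a i) = k' by omega, h5]; exact hyS))
    exact hyq ((hqs _).2 ⟨k', by omega, h4, h5⟩)
  have hsv : ∀ i, f (a i + d i) ∉ range v := by
    rintro i ⟨j, hj⟩
    have hij : j ≠ i := by
      rintro rfl
      exact hne j hj.symm
    refine hnopath i ((p j).copy rfl hj) (by simpa using hp j) (fun y hy hyf => ?_)
      (fun y hy hy' => hpp j i hij y (by simpa using hy) hy')
    rw [← hj]
    exact (hpf j y (by simpa using hy)).1 hyf
  have hsS : ∀ i, f (a i + d i) ∈ S := fun i => (hd i).2.resolve_right (hsv i)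
  have hpos : ∀ i j, i ≠ j → ∃ b, f b = v j ∧ f (b + d j) = f (a j + d j) ∧ a i + d i < b ∧
      b + d j < a i + n := by
    intro i j hij
    obtain ⟨b, h1, h2, h3⟩ := hother i j hij
    have hb : ∀ e, f (b + e) = f (a j + e) := fun e =>
      (hinj _ _).2 (Nat.ModEq.add_right e ((hinj _ _).1 (by rw [h3, ha])))
    refine ⟨b, h3, hb _, ?_, ?_⟩
    · have h4 := hdle i (b - a i) (by omega)
        (Or.inr ⟨j, by rw [show a i + (b - a i) = b by omega, h3]⟩)
      have h5 : a i + d i ≠ b := fun h => hsv i ⟨j, by rw [h, h3]⟩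
      omega
    · have h4 : f (a i + n) = v i := by rw [hper, ha]
      have h6 := hdle j (a i + n - b) (by omega)
        (Or.inr ⟨i, by rw [← hb, show b + (a i + n - b) = a i + n by omega, h4]⟩)
      have h5 : b + d j ≠ a i + n := fun h => hsv j ⟨i, by rw [← hb, h, h4]⟩
      omega
  refine ⟨fun i => f (a i + d i), fun i j hij => ?_, fun i => ⟨hsS i, ⟨_, rfl⟩, hsv i, fun h => ?_⟩,
    fun i j hij h => ?_⟩
  · by_contra hne'
    obtain ⟨b, h1, h2, h3, h4⟩ := hpos i j hne'
    have h5 : f (a i + d i) = f (b + d j) := hij.trans h2.symm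
    have := modEq_injOn (a := a i) ⟨by have := (hd i).1; omega, by omega⟩ (by omega)
      ((hinj _ _).1 h5)
    omega
  · refine hnopath i (Walk.cons h Walk.nil) ?_ ?_ ?_
    · simpa using h.ne
    · intro y hy hyf
      simp only [Walk.support_cons, Walk.support_nil, List.mem_cons, List.not_mem_nil,
        or_false] at hy
      exact hy.resolve_left fun h0 => hx (h0 ▸ hyf)
    · intro y hy hyp
      simp only [Walk.support_cons, Walk.support_nil, List.mem_cons, List.not_mem_nil,
        or_false] at hy
      refine hy.resolve_right fun h0 => ?_
      subst h0
      exact hne i ((hpf i _ hyp).1 ⟨_, rfl⟩)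
  · obtain ⟨b, h1, h2, h3, h4⟩ := hpos i j hij
    have hdi := (hd i).1
    have hdj := (hd j).1
    dsimp only at h
    rw [← h2] at h
    obtain ⟨q₁, hq₁, hs₁⟩ := exists_isPath_of_modEq hadj hinj (a := a i + d i) (b := b)
      (by omega) (by omega)
    obtain ⟨q₂, hq₂, hs₂⟩ := exists_isPath_of_modEq hadj hinj (a := b + d j) (b := a i + n)
      (by omega) (by omega)
    have hdisj : ∀ k l, a i + d i ≤ k → k ≤ b → b + d j ≤ l → l ≤ a i + n → f k ≠ f l := by
      intro k l hk1 hk2 hl1 hl2 hkl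
      have := modEq_injOn (a := a i) (by omega) (by omega) ((hinj _ _).1 hkl)
      omega
    have hq₂' : (Walk.cons h q₂).IsPath := by
      rw [Walk.cons_isPath_iff]
      refine ⟨hq₂, fun hmem => ?_⟩
      obtain ⟨l, hl1, hl2, hl⟩ := (hs₂ _).1 hmem
      exact hdisj _ l le_rfl h3.le hl1 hl2 hl.symm
    have hq : (q₁.reverse.append (Walk.cons h q₂)).IsPath := by
      refine hq₁.reverse.append_of_inter hq₂' fun y hy hy' => ?_
      rw [Walk.support_reverse, List.mem_reverse] at hy
      rw [Walk.support_cons, List.mem_cons] at hy'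
      refine hy'.resolve_right fun hmem => ?_
      obtain ⟨k, hk1, hk2, rfl⟩ := (hs₁ y).1 hy
      obtain ⟨l, hl1, hl2, hl⟩ := (hs₂ _).1 hmem
      exact hdisj k l hk1 hk2 hl1 hl2 hl.symm
    have hqs : ∀ y, y ∈ (q₁.reverse.append (Walk.cons h q₂)).support ↔
        y ∈ q₁.support ∨ y ∈ q₂.support := by
      intro y
      rw [Walk.mem_support_append_iff, Walk.support_reverse, List.mem_reverse, Walk.support_cons,
        List.mem_cons]
      constructor
      · rintro (h | rfl | h)
        · exact Or.inl h
        · exact Or.inl q₁.start_mem_support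
        · exact Or.inr h
      · tauto
    have hend : v i = f (a i + n) := by rw [hper, ha]
    obtain ⟨y, hyS, ⟨k, rfl⟩, hyq⟩ := hmax _ _ ((p j).copy rfl h1.symm) ((p i).copy rfl hend) _
      (by simpa using hp j) (by simpa using hp i) hq
      (by rw [h1, ← hend]; exact hv.ne hij.symm)
      (fun y hy hyf => by
        rw [h1]
        exact (hpf j y (by simpa using hy)).1 hyf)
      (fun y hy hyf => by
        rw [← hend]
        exact (hpf i y (by simpa using hy)).1 hyf)
      (fun y hy hy' => hpp j i hij.symm y (by simpa using hy) (by simpa using hy'))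
      (fun y hy => by
        rcases (hqs y).1 hy with hy | hy
        · obtain ⟨k, -, -, rfl⟩ := (hs₁ y).1 hy
          exact ⟨k, rfl⟩
        · obtain ⟨k, -, -, rfl⟩ := (hs₂ y).1 hy
          exact ⟨k, rfl⟩)
    rw [hqs, not_or] at hyq
    obtain ⟨k', h5, h6, h7⟩ := hrep (a i) k
    rw [← h7] at hyq hyS
    have h8 := hdle i (k' - a i) (by omega)
      (Or.inl (by rw [show a i + (k' - a i) = k' by omega]; exact hyS))
    have h9 : b < k' := not_le.1 fun hle => hyq.1 ((hs₁ _).2 ⟨k', by omega, hle, rfl⟩)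
    have h10 : f (a j + (k' - b)) = f k' := by
      rw [hinj]
      have : a j ≡ b [MOD n] := (hinj _ _).1 (by rw [ha, h1])
      simpa [show b + (k' - b) = k' by omega] using this.add_right (k' - b)
    have h11 := hdle j (k' - b) (by omega) (Or.inl (by rw [h10]; exact hyS))
    exact hyq.2 ((hs₂ _).2 ⟨k', by omega, h6, rfl⟩)

theorem Walk.IsCycle.exists_parametrization {G : SimpleGraph V} {u : V} {c : G.Walk u u}
    (hc : c.IsCycle) : ∃ (n : ℕ) (f : ℕ → V), 3 ≤ n ∧ (∀ k, G.Adj (f k) (f (k + 1))) ∧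
      (∀ a b, f a = f b ↔ a ≡ b [MOD n]) ∧ ∀ y, y ∈ range f ↔ y ∈ c.support := by
  have hn := hc.three_le_length
  have hpos : 0 < c.length := by omega
  refine ⟨c.length, fun k => c.getVert (k % c.length), hn, fun k => ?_, fun a b => ?_, fun y => ?_⟩
  · have hlt := Nat.mod_lt k hpos
    have h := c.adj_getVert_succ hlt
    have h2 : c.getVert ((k + 1) % c.length) = c.getVert (k % c.length + 1) := by
      rw [Nat.add_mod, Nat.mod_eq_of_lt (show 1 < c.length by omega)]
      rcases (show k % c.length + 1 ≤ c.length from hlt).lt_or_eq with h' | h'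
      · rw [Nat.mod_eq_of_lt h']
      · rw [h', Nat.mod_self, Walk.getVert_zero, Walk.getVert_length]
    simp only [h2]
    exact h
  · refine ⟨fun h => ?_, fun h => by simp only; rw [h]⟩
    have h1 := Nat.mod_lt a hpos
    have h2 := Nat.mod_lt b hpos
    exact hc.getVert_injOn' (by simp only [mem_ofPred_eq]; omega)
      (by simp only [mem_ofPred_eq]; omega) h
  · rw [Walk.mem_support_iff_exists_getVert]
    constructor
    · rintro ⟨k, rfl⟩
      exact ⟨_, rfl, (Nat.mod_lt k hpos).le⟩
    · rintro ⟨k, rfl, hk⟩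
      refine ⟨k, ?_⟩
      rcases hk.lt_or_eq with h | rfl
      · simp only [Nat.mod_eq_of_lt h]
      · simp

theorem connected_of_forall_induce_compl_singleton [Fintype V] {G : SimpleGraph V}
    (hcard : 2 < Fintype.card V)
    (h2conn : ∀ v : V, (G.induce ({v}ᶜ : Set V)).Connected) : G.Connected := by
  classical
  have : Nonempty V := Fintype.card_pos_iff.1 (by omega)
  refine ⟨fun u w => ?_⟩
  obtain ⟨v, -, hv⟩ := Finset.exists_mem_notMem_of_card_lt_card
    (s := {u, w}) (t := Finset.univ) (Finset.card_le_two.trans_lt (by simpa using hcard))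
  simp only [Finset.mem_insert, Finset.mem_singleton, not_or] at hv
  exact ((h2conn v).preconnected ⟨u, fun h => hv.1 h.symm⟩ ⟨w, fun h => hv.2 h.symm⟩).map
    (Embedding.induce _).toHom

theorem exists_isCycle_of_forall_induce_compl_singleton [Fintype V] {G : SimpleGraph V}
    (hcard : 2 < Fintype.card V)
    (h2conn : ∀ v : V, (G.induce ({v}ᶜ : Set V)).Connected) :
    ∃ (u : V) (c : G.Walk u u), c.IsCycle := by
  classical
  by_contra! hno
  have hacyc : G.IsAcyclic := fun u c => hno u c
  have : Nontrivial V := Fintype.one_lt_card_iff_nontrivial.1 (by omega)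
  have htree : G.IsTree := ⟨connected_of_forall_induce_compl_singleton hcard h2conn, hacyc⟩
  obtain ⟨v, hv⟩ := htree.exists_vert_degree_one_of_nontrivial
  obtain ⟨w, hvw, hw⟩ := degree_eq_one_iff_existsUnique_adj.1 hv
  obtain ⟨u, -, hu⟩ := Finset.exists_mem_notMem_of_card_lt_card
    (s := {v, w}) (t := Finset.univ) (Finset.card_le_two.trans_lt (by simpa using hcard))
  simp only [Finset.mem_insert, Finset.mem_singleton, not_or] at hu
  have hr := (h2conn w).preconnected ⟨v, hvw.ne⟩ ⟨u, hu.2⟩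
  have := hr.mem_of_forall_adj (U := {z | z.1 = v}) rfl (by
    rintro ⟨z, hz⟩ ⟨y, hy⟩ rfl hadj
    exact (hy (hw y hadj)).elim)
  exact hu.1 this

end SimpleGraph

theorem ncard_le_indepNumOn [Fintype V] {G : SimpleGraph V} {S I : Set V} (hI : I ⊆ S)
    (hind : I.Pairwise (fun a b => ¬ G.Adj a b)) : I.ncard ≤ indepNumOn G S :=
  le_csSup ⟨Nat.card V, by
    rintro n ⟨J, -, -, rfl⟩
    exact ncard_le_card J⟩ ⟨I, hI, hind, rfl⟩

theorem connected_induce_compl_of_card_lt_vertexConn [Fintype V] (G : SimpleGraph V)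
    {X : Finset V} (hX : X.card < vertexConn G) : (G.induce ((↑X : Set V)ᶜ)).Connected := by
  have hmem := Nat.sSup_mem (s := {k | k < Fintype.card V ∧ ∀ X : Finset V, X.card < k →
    (G.induce ((↑X : Set V)ᶜ)).Connected}) (by
      by_contra h
      rw [not_nonempty_iff_eq_empty] at h
      rw [vertexConn, h] at hX
      simp at hX) ⟨Fintype.card V, fun k hk => hk.1.le⟩
  exact hmem.2 X hX

theorem two_le_vertexConn [Fintype V] {G : SimpleGraph V} (hcard : 2 < Fintype.card V)
    (h2conn : ∀ v : V, (G.induce ({v}ᶜ : Set V)).Connected) : 2 ≤ vertexConn G := by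
  refine le_csSup ⟨Fintype.card V, fun k hk => hk.1.le⟩ ⟨hcard, fun X hX => ?_⟩
  rcases Nat.eq_zero_or_pos X.card with h | h
  · rw [Finset.card_eq_zero] at h
    subst h
    rw [Finset.coe_empty, compl_empty]
    exact (induceUnivIso G).connected_iff.2
      (connected_of_forall_induce_compl_singleton hcard h2conn)
  · obtain ⟨v, rfl⟩ := Finset.card_eq_one.1 (show X.card = 1 by omega)
    rw [Finset.coe_singleton]
    exact h2conn v

/-- Fournier: if `G` is 2-connected and `α_G(S) ≤ κ(G)`, then `G` has a cycle
covering `S`. -/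
theorem stmt_11 [Fintype V] (G : SimpleGraph V)
    (hcard : 2 < Fintype.card V)
    (h2conn : ∀ v : V, (G.induce ({v}ᶜ : Set V)).Connected)
    (S : Set V) (hακ : indepNumOn G S ≤ vertexConn G) :
    ∃ (u : V) (c : G.Walk u u), c.IsCycle ∧ S ⊆ {x | x ∈ c.support} := by
  classical
  set K : Set ℕ := {m | ∃ (u : V) (c : G.Walk u u), c.IsCycle ∧
    {y | y ∈ S ∧ y ∈ c.support}.ncard = m}
  have hbdd : BddAbove K := ⟨Nat.card V, by
    rintro m ⟨u, c, -, rfl⟩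
    exact ncard_le_card _⟩
  have hne : K.Nonempty := by
    obtain ⟨u, c, hc⟩ := exists_isCycle_of_forall_induce_compl_singleton hcard h2conn
    exact ⟨_, u, c, hc, rfl⟩
  obtain ⟨u, c, hc, hcK⟩ := Nat.sSup_mem hne hbdd
  refine ⟨u, c, hc, fun x hxS => ?_⟩
  by_contra hxc
  obtain ⟨n, f, hn, hadj, hinj, hrange⟩ := hc.exists_parametrization
  have hκ := two_le_vertexConn hcard h2conn
  have hA : ∀ y, y ∈ c.support.toFinset ↔ y ∈ range f := fun y => by
    rw [List.mem_toFinset, hrange]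
  have hA2 : 2 ≤ c.support.toFinset.card := by
    have h01 : f 0 ≠ f 1 := (hadj 0).ne
    calc 2 = ({f 0, f 1} : Finset V).card := (Finset.card_pair h01).symm
      _ ≤ _ := Finset.card_le_card fun y hy => by
        rw [Finset.mem_insert, Finset.mem_singleton] at hy
        rw [hA]
        rcases hy with rfl | rfl
        exacts [⟨0, rfl⟩, ⟨1, rfl⟩]
  obtain ⟨v, p, hp, hpA, hpp⟩ := exists_fan G (x := x) (A := c.support.toFinset)
    (t := min (vertexConn G) c.support.toFinset.card) (by simpa using hxc) (min_le_right _ _)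
    (fun X hX => connected_induce_compl_of_card_lt_vertexConn G
      (hX.trans_le (min_le_left _ _)))
  have hvinj : Function.Injective v := by
    intro i j h
    by_contra hij
    have h1 := hpp i j hij (v i) (p i).end_mem_support (by rw [h]; exact (p j).end_mem_support)
    have h2 := (hpA i _ (p i).end_mem_support).2 rfl
    rw [h1, List.mem_toFinset] at h2
    exact hxc h2
  have ht := le_min hκ hA2
  obtain ⟨s, hsinj, hs, hsind⟩ := exists_indep_of_fan (S := S) (x := x) (by omega) hadj hinj
    (by rw [hrange]; exact hxc) (by
      intro u w p p' q hp hp' hq huw hpf hpf' hpp' hqf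
      by_contra! hcon
      have hxq : x ∉ q.support := fun h => hxc ((hrange x).1 (hqf x h))
      obtain ⟨z, c', hc', hxc', hqc'⟩ := exists_isCycle_of_isPath_triangle hp hp' hq huw hxq
        (fun y hy hyq => hpf y hy (hqf y hyq)) (fun y hy hyq => hpf' y hy (hqf y hyq)) hpp'
      have hlt : {y | y ∈ S ∧ y ∈ c.support}.ncard < {y | y ∈ S ∧ y ∈ c'.support}.ncard := by
        refine ncard_lt_ncard ⟨fun y hy => ⟨hy.1, hqc' y (hcon y hy.1 ((hrange y).2 hy.2))⟩,
          fun hsub => hxc (hsub ⟨hxS, hxc'⟩).2⟩ (toFinite _)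
      have hle := le_csSup hbdd ⟨z, c', hc', rfl⟩
      omega)
    ht hvinj p hp (fun i y hy => by rw [← hA]; exact hpA i y hy) hpp
  have htκ : min (vertexConn G) c.support.toFinset.card = vertexConn G := by
    refine (min_choice _ _).resolve_right fun h => ?_
    have hsub : Finset.univ.image v ⊂ c.support.toFinset := by
      refine Finset.ssubset_iff_subset_ne.2 ⟨fun y hy => ?_, fun heq => ?_⟩
      · obtain ⟨i, -, rfl⟩ := Finset.mem_image.1 hy
        exact (hpA i _ (p i).end_mem_support).2 rfl
      · obtain ⟨-, h1, h2, -⟩ := hs ⟨0, by omega⟩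
        obtain ⟨i, -, hi⟩ := Finset.mem_image.1 (heq.ge ((hA _).2 h1))
        exact h2 ⟨i, hi⟩
    have := Finset.card_lt_card hsub
    rw [Finset.card_image_of_injective _ hvinj, Finset.card_univ, Fintype.card_fin] at this
    omega
  have hxs : x ∉ range s := by
    rintro ⟨i, rfl⟩
    exact hxc ((hrange _).1 (hs i).2.1)
  have hI := ncard_le_indepNumOn (G := G) (S := S) (I := insert x (range s))
    (insert_subset hxS (by rintro _ ⟨i, rfl⟩; exact (hs i).1)) (by
      rintro y (rfl | ⟨i, rfl⟩) z (rfl | ⟨j, rfl⟩) hyz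
      · exact (hyz rfl).elim
      · exact (hs j).2.2.2
      · exact fun h => (hs i).2.2.2 h.symm
      · exact hsind i j fun h => hyz (by rw [h]))
  rw [ncard_insert_of_notMem hxs (toFinite _), ncard_range_of_injective hsinj,
    Nat.card_eq_fintype_card, Fintype.card_fin] at hI
  omega
end
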